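/- arXiv:0810.2235 — 5 statements merged into one kernel-verified Lean document; each statement's English description precedes it below -/
import Mathlib

section
/- (Vaaler's approximation.) For every w ∈ ℝ and every positive integer H, one has |ψ(w) + Σ_H(w)| ≤ Σ*_H(w), where ψ(w) = w − ⌊w⌋ − 1/2, Σ_H(w) = Σ_{h=1}^H α_{h,H} sin(2πhw), Σ*_H(w) = Σ_{h=1}^H β_{h,H} cos(2πhw) + 1/(2H+2), with α_{h,H} = (1/(πh)) ρ(h/(H+1)), β_{h,H} = (1/(H+1))(1 − h/(H+1)), and ρ(ξ) = πξ(1−ξ)cot(πξ) + ξ for 0 < ξ < 1. -/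
open Real Finset

lemma sin_mul_sum_sin_two_mul (H : ℕ) (y : ℝ) :
    sin y * ∑ h ∈ Icc 1 H, sin (2 * h * y) = sin ((H + 1) * y) * sin (H * y) := by
  induction H with
  | zero => simp
  | succ n ih =>
    rw [Finset.sum_Icc_succ_top (by omega), mul_add, ih]
    push_cast
    have h1 : (n : ℝ) * y = (n + 1) * y - y := by ring
    have h2 : ((n : ℝ) + 1 + 1) * y = (n + 1) * y + y := by ring
    have h3 : 2 * ((n : ℝ) + 1) * y = 2 * ((n + 1) * y) := by ring
    rw [h1, h2, h3, sin_sub, sin_add, sin_two_mul]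
    ring

lemma sin_mul_one_add_sum_cos_two_mul (H : ℕ) (y : ℝ) :
    sin y * (1 + 2 * ∑ h ∈ Icc 1 H, cos (2 * h * y)) = sin ((2 * H + 1) * y) := by
  induction H with
  | zero => simp
  | succ n ih =>
    rw [Finset.sum_Icc_succ_top (by omega), mul_add 2, ← add_assoc, mul_add, ih]
    push_cast
    have h1 : (2 * (n : ℝ) + 1) * y = 2 * (n + 1) * y - y := by ring
    have h2 : (2 * ((n : ℝ) + 1) + 1) * y = 2 * (n + 1) * y + y := by ring
    rw [h1, h2, sin_sub, sin_add]
    ring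

/-- The closed form of the Fejér kernel. -/
lemma sin_sq_mul_fejer (H : ℕ) (y : ℝ) :
    sin y ^ 2 * ((H + 1) + 2 * ∑ h ∈ Icc 1 H, ((H : ℝ) + 1 - h) * cos (2 * h * y)) =
      sin ((H + 1) * y) ^ 2 := by
  induction H with
  | zero => simp
  | succ n ih =>
    have hs : ∑ h ∈ Icc 1 (n + 1), (((n + 1 : ℕ) : ℝ) + 1 - h) * cos (2 * h * y) =
        ∑ h ∈ Icc 1 n, ((n : ℝ) + 1 - h) * cos (2 * h * y) +
          ∑ h ∈ Icc 1 (n + 1), cos (2 * h * y) := by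
      rw [Finset.sum_Icc_succ_top (by omega), Finset.sum_Icc_succ_top (by omega), ← add_assoc,
        ← Finset.sum_add_distrib]
      push_cast
      congr 1
      · exact Finset.sum_congr rfl fun h _ => by ring
      · ring
    have hd := sin_mul_one_add_sum_cos_two_mul (n + 1) y
    rw [hs]
    push_cast at hd ⊢
    have h1 : (2 * ((n : ℝ) + 1) + 1) * y = (n + 1) * y + ((n + 1) * y + y) := by ring
    have h2 : ((n : ℝ) + 1 + 1) * y = (n + 1) * y + y := by ring
    rw [h1, sin_add ((n + 1) * y)] at hd
    rw [h2]
    rw [sin_add, cos_add] at *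
    linear_combination ih + sin y * hd - sin ((n + 1) * y) ^ 2 * sin_sq_add_cos_sq y

lemma two_mul_sin_mul_sum_cos (n : ℕ) (a θ : ℝ) :
    2 * sin θ * ∑ k ∈ range n, cos (a - 2 * k * θ) =
      sin (a + θ) - sin (a + θ - 2 * n * θ) := by
  induction n with
  | zero => simp
  | succ n ih =>
    rw [Finset.sum_range_succ, mul_add, ih]
    push_cast
    have h1 : a + θ - 2 * n * θ = (a - 2 * n * θ) + θ := by ring
    have h2 : a + θ - 2 * (n + 1) * θ = (a - 2 * n * θ) - θ := by ring
    rw [h1, h2, sin_sub _ θ, sin_add (a - 2 * n * θ)]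
    ring

lemma two_mul_sin_mul_sum_mul_cos (n : ℕ) (a θ : ℝ) :
    2 * sin θ * ∑ k ∈ range n, k * cos (a - 2 * k * θ) =
      ∑ k ∈ range n, sin (a - θ - 2 * k * θ) - n * sin (a + θ - 2 * n * θ) := by
  induction n with
  | zero => simp
  | succ n ih =>
    rw [Finset.sum_range_succ, mul_add, ih, Finset.sum_range_succ]
    push_cast
    have h1 : a + θ - 2 * n * θ = (a - 2 * n * θ) + θ := by ring
    have h2 : a + θ - 2 * (n + 1) * θ = (a - 2 * n * θ) - θ := by ring
    have h3 : a - θ - 2 * n * θ = (a - 2 * n * θ) - θ := by ring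
    rw [h1, h2, h3, sin_sub _ θ, sin_add (a - 2 * n * θ)]
    ring

section Orthogonality

variable {N h : ℕ} {θ : ℝ}

lemma sum_cos_sub_eq_zero (hθ : N * θ = h * π) (hs : sin θ ≠ 0) (a : ℝ) :
    ∑ k ∈ range N, cos (a - 2 * k * θ) = 0 := by
  have := two_mul_sin_mul_sum_cos N a θ
  rw [show a + θ - 2 * N * θ = a + θ - h * (2 * π) by linear_combination -2 * hθ,
    sin_sub_nat_mul_two_pi, sub_self] at this
  simpa [hs] using this

lemma sum_sin_sub_eq_zero (hθ : N * θ = h * π) (hs : sin θ ≠ 0) (a : ℝ) :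
    ∑ k ∈ range N, sin (a - 2 * k * θ) = 0 := by
  rw [← sum_cos_sub_eq_zero hθ hs (a - π / 2)]
  refine Finset.sum_congr rfl fun k _ => ?_
  rw [← cos_sub_pi_div_two]
  ring_nf

lemma sum_mul_cos_sub (hθ : N * θ = h * π) (hs : sin θ ≠ 0) (a : ℝ) :
    ∑ k ∈ range N, k * cos (a - 2 * k * θ) = -(N / 2) * (cot θ * sin a + cos a) := by
  have := two_mul_sin_mul_sum_mul_cos N a θ
  rw [show a + θ - 2 * N * θ = a + θ - h * (2 * π) by linear_combination -2 * hθ,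
    sin_sub_nat_mul_two_pi, sum_sin_sub_eq_zero hθ hs, sin_add] at this
  rw [cot_eq_cos_div_sin]
  apply mul_left_cancel₀ (mul_ne_zero two_ne_zero hs)
  rw [this]
  field_simp
  ring

end Orthogonality

lemma mul_cos_le_sin {a : ℝ} (h0 : 0 < a) (hπ : a < π) : a * cos a ≤ sin a := by
  rcases lt_or_ge a (π / 2) with h | h
  · have hc := cos_pos_of_mem_Ioo ⟨by linarith, h⟩
    have := lt_tan h0 h
    rw [tan_eq_sin_div_cos, lt_div_iff₀ hc] at this
    exact this.le
  · have := cos_nonpos_of_pi_div_two_le_of_le h (by linarith)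
    nlinarith [sin_pos_of_pos_of_lt_pi h0 hπ]

lemma mul_sin_add_le {v d : ℝ} (hv : 0 < v) (hd : 0 < d) (hvd : v + d < π) :
    v * sin (v + d) ≤ (v + d) * sin v := by
  have hsv := sin_pos_of_pos_of_lt_pi hv (by linarith)
  have hsd := sin_pos_of_pos_of_lt_pi hd (by linarith)
  have h1 := mul_le_mul_of_nonneg_right (mul_cos_le_sin hv (by linarith)) hsd.le
  have h2 := mul_le_mul_of_nonneg_left (cos_le_one d) (mul_pos hv hsv).le
  have h3 := mul_le_mul_of_nonneg_left (sin_lt hd).le hsv.le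
  rw [sin_add]
  linarith

lemma mul_mul_sin_add_le {a b : ℝ} (ha : 0 < a) (hb : 0 < b) (hab : a + b < π) :
    a * b * sin (a + b) ≤ (a + b) * (sin a * sin b) := by
  have h1 := mul_le_mul_of_nonneg_left (mul_cos_le_sin ha (by linarith))
    (mul_pos hb (sin_pos_of_pos_of_lt_pi hb (by linarith))).le
  have h2 := mul_le_mul_of_nonneg_left (mul_cos_le_sin hb (by linarith))
    (mul_pos ha (sin_pos_of_pos_of_lt_pi ha (by linarith))).le
  rw [sin_add]
  linarith

/-- The tangent line inequality expressing the concavity of `u ↦ u * cot u` on `(-π, π)`. -/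
lemma mul_cot_le_tangent {u d : ℝ} (hu : u < π) (hd : 0 < d) (hdπ : d < π) (hv : -π < u - d)
    (hu0 : u ≠ 0) (hv0 : u - d ≠ 0) :
    (u - d) * (cot (u - d) - cot u) ≤ d * (u / sin u ^ 2) := by
  have hsu : sin u ≠ 0 := fun h => hu0 ((sin_eq_zero_iff_of_lt_of_lt (by linarith) hu).1 h)
  have hsv : sin (u - d) ≠ 0 := fun h =>
    hv0 ((sin_eq_zero_iff_of_lt_of_lt hv (by linarith)).1 h)
  have hsd := sin_pos_of_pos_of_lt_pi hd hdπ
  have hcot : cot (u - d) - cot u = sin d / (sin u * sin (u - d)) := by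
    rw [cot_eq_cos_div_sin, cot_eq_cos_div_sin]
    have : sin d = sin u * cos (u - d) - cos u * sin (u - d) := by
      rw [← sin_sub]; congr 1; ring
    rw [this]
    field_simp
  rw [hcot]
  obtain ⟨v, rfl⟩ : ∃ v, u = v + d := ⟨u - d, by ring⟩
  rw [add_sub_cancel_right] at *
  suffices h : 0 ≤ (d * (v + d) * sin v - v * sin d * sin (v + d)) * sin v by
    have : d * ((v + d) / sin (v + d) ^ 2) - v * (sin d / (sin (v + d) * sin v)) =
        ((d * (v + d) * sin v - v * sin d * sin (v + d)) * sin v) /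
          (sin (v + d) ^ 2 * sin v ^ 2) := by
      field_simp
    rw [← sub_nonneg, this]
    positivity
  rcases lt_or_gt_of_ne hv0 with h | h
  · have hsv' := sin_neg_of_neg_of_neg_pi_lt h hv
    refine mul_nonneg_of_nonpos_of_nonpos ?_ hsv'.le
    rcases lt_or_gt_of_ne hu0 with h' | h'
    · have := mul_mul_sin_add_le (a := -(v + d)) (b := d) (by linarith) hd (by linarith)
      rw [show -(v + d) + d = -v by ring, sin_neg, sin_neg] at this
      linarith
    · have h1 := mul_sin_add_le (v := -v) (d := v + d) (by linarith) h' (by linarith)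
      rw [show -v + (v + d) = d by ring, sin_neg] at h1
      have h2 := mul_le_mul_of_nonneg_right h1 h'.le
      have h3 := mul_le_mul_of_nonneg_left (sin_lt h').le (mul_pos (neg_pos.2 h) hsd).le
      linarith
  · have hsv' := sin_pos_of_pos_of_lt_pi h (by linarith)
    refine mul_nonneg ?_ hsv'.le
    have h1 := mul_le_mul_of_nonneg_left (mul_sin_add_le h hd hu) hsd.le
    have h2 := mul_le_mul_of_nonneg_left (sin_lt hd).le
      (mul_pos (show 0 < v + d by linarith) hsv').le
    linarith

/-- Comparison of a Riemann sum of the decreasing function `(u * cot u)'` with its integral. -/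
lemma mul_cot_add_sum_nonneg {N : ℕ} (hN : 2 ≤ N) {y : ℝ} (hy0 : 0 < y) (hyπ : y < π)
    (hne : ∀ k < N, y - k * (π / N) ≠ 0) :
    0 ≤ ∑ k ∈ range N, (y - k * (π / N)) / sin (y - k * (π / N)) ^ 2 -
      ∑ k ∈ range N, cot (y - k * (π / N)) + N * cot y := by
  have hN' : (2 : ℝ) ≤ N := by exact_mod_cast hN
  set d := π / N with hd
  have hNd : N * d = π := by rw [hd]; field_simp
  have hd0 : 0 < d := by positivity
  have hdπ : d < π := by nlinarith
  set f : ℕ → ℝ := fun k => (y - k * d) * cot (y - k * d) with hf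
  have key : ∀ k ∈ range N, f (k + 1) - f k + d * cot (y - k * d) ≤
      d * ((y - k * d) / sin (y - k * d) ^ 2) := by
    intro k hk
    have hk := Finset.mem_range.1 hk
    have hk1 : ((k : ℝ) + 1) * d ≤ N * d :=
      mul_le_mul_of_nonneg_right (by exact_mod_cast hk) hd0.le
    have hkd : 0 ≤ (k : ℝ) * d := by positivity
    have hv0 : y - k * d - d ≠ 0 := by
      rcases Nat.lt_or_ge (k + 1) N with h | h
      · have := hne (k + 1) h
        push_cast at this
        rwa [show y - k * d - d = y - (k + 1) * d by ring]
      · have : N = k + 1 := by omega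
        have : (N : ℝ) = k + 1 := by exact_mod_cast this
        rw [this] at hNd
        intro h0
        linarith
    have := mul_cot_le_tangent (u := y - k * d) (d := d) (by linarith) hd0 hdπ (by linarith)
      (hne k hk) hv0
    simp only [hf]
    push_cast
    rw [show y - (k + 1) * d = y - k * d - d by ring]
    linarith
  have hsum := Finset.sum_le_sum key
  rw [Finset.sum_add_distrib, Finset.sum_range_sub, ← Finset.mul_sum, ← Finset.mul_sum] at hsum
  have hcot : cot (y - π) = cot y := by
    rw [cot_eq_cos_div_sin, cot_eq_cos_div_sin, cos_sub_pi, sin_sub_pi, neg_div_neg_eq]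
  simp only [hf, hNd, hcot, Nat.cast_zero, zero_mul, sub_zero] at hsum
  refine nonneg_of_mul_nonneg_right (a := d) ?_ hd0
  linear_combination hsum - cot y * hNd

lemma sin_sub_nat_mul_pi_sq (t : ℝ) (k : ℕ) : sin (t - k * π) ^ 2 = sin t ^ 2 := by
  rw [sin_sub_nat_mul_pi, mul_pow, ← pow_mul, mul_comm k, pow_mul]
  simp

lemma sin_mul_cos_sub_nat_mul_pi (t : ℝ) (k : ℕ) :
    sin (t - k * π) * cos (t - k * π) = sin t * cos t := by
  have h : 2 * (sin (t - k * π) * cos (t - k * π)) = 2 * (sin t * cos t) := by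
    rw [← mul_assoc, ← sin_two_mul, ← mul_assoc, ← sin_two_mul,
      show 2 * (t - k * π) = 2 * t - k * (2 * π) by ring, sin_sub_nat_mul_two_pi]
  linarith

lemma sum_sin_two_mul_eq (H : ℕ) {y : ℝ} (hs : sin y ≠ 0) :
    ∑ h ∈ Icc 1 H, sin (2 * h * y) =
      sin ((H + 1) * y) ^ 2 * cot y - sin ((H + 1) * y) * cos ((H + 1) * y) := by
  have h := sin_mul_sum_sin_two_mul H y
  rw [show (H : ℝ) * y = (H + 1) * y - y by ring, sin_sub] at h
  apply mul_left_cancel₀ hs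
  rw [h, cot_eq_cos_div_sin]
  field_simp

/-- The lower bound in Vaaler's inequality, away from the interpolation nodes. -/
lemma vaaler_lower {H : ℕ} (hH : 0 < H) {x : ℝ} (hx0 : 0 < x) (hx1 : x < 1)
    (hS : sin ((H + 1) * (π * x)) ≠ 0) :
    0 ≤ x - 1 / 2 +
        ∑ h ∈ Icc 1 H,
          (1 / (π * h) * (π * ((h : ℝ) / (H + 1)) * (1 - (h : ℝ) / (H + 1)) *
            cot (π * ((h : ℝ) / (H + 1))) + (h : ℝ) / (H + 1))) * sin (2 * π * h * x) +
      ((∑ h ∈ Icc 1 H,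
          (1 / ((H : ℝ) + 1) * (1 - (h : ℝ) / (H + 1))) * cos (2 * π * h * x)) +
        1 / (2 * H + 2)) := by
  set y := π * x with hy
  have hy0 : 0 < y := by positivity
  have hyπ : y < π := by nlinarith [pi_pos]
  obtain ⟨N, hN⟩ : ∃ N, N = H + 1 := ⟨_, rfl⟩
  have hNR : (H : ℝ) + 1 = N := by rw [hN]; push_cast; rfl
  have hN2 : 2 ≤ N := by omega
  have hN0 : (N : ℝ) ≠ 0 := by positivity
  have hπ := pi_ne_zero
  set u : ℕ → ℝ := fun k => y - k * (π / N) with hu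
  have hNu : ∀ k, N * u k = N * y - k * π := fun k => by simp only [hu]; field_simp
  rw [hNR] at hS
  have hu0 : ∀ k < N, u k ≠ 0 := by
    intro k _ h
    have := hNu k
    rw [h, mul_zero] at this
    apply hS
    rw [show (N : ℝ) * y = k * π by linarith]
    exact sin_nat_mul_pi k
  have hsu : ∀ k ∈ range N, sin (u k) ≠ 0 := by
    intro k hk h
    have hk := Finset.mem_range.1 hk
    have hk1 : (k : ℝ) * (π / N) ≤ N * (π / N) := by gcongr
    have hk0 : 0 ≤ (k : ℝ) * (π / N) := by positivity
    rw [mul_div_cancel₀ _ hN0] at hk1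
    exact hu0 k hk ((sin_eq_zero_iff_of_lt_of_lt (by simp only [hu]; linarith)
      (by simp only [hu]; linarith)).1 h)
  have hangle : ∀ h ∈ Icc 1 H, sin (π * (h / N)) ≠ 0 ∧ (h : ℝ) ≠ 0 := by
    intro h hh
    obtain ⟨h1, h2⟩ := Finset.mem_Icc.1 hh
    have h1' : (0 : ℝ) < h := by exact_mod_cast h1
    have h2' : (h : ℝ) < N := by exact_mod_cast (by omega : h < N)
    have : (h : ℝ) / N < 1 := (div_lt_one (by positivity)).2 h2'
    refine ⟨(sin_pos_of_pos_of_lt_pi (by positivity) ?_).ne', h1'.ne'⟩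
    nlinarith [pi_pos]
  have hθ : ∀ h : ℕ, (N : ℝ) * (π * (h / N)) = h * π := fun h => by field_simp
  have harg : ∀ h k : ℕ, 2 * h * u k = 2 * h * y - 2 * k * (π * (h / N)) := fun h k => by
    simp only [hu]; ring
  set S := sin (N * y) with hSdef
  set C := cos (N * y) with hCdef
  have hfejer : ∀ k ∈ range N, S ^ 2 * (1 / sin (u k) ^ 2) =
      N + 2 * ∑ h ∈ Icc 1 H, ((N : ℝ) - h) * cos (2 * h * u k) := by
    intro k hk
    have h := sin_sq_mul_fejer H (u k)
    rw [hNR, hNu, sin_sub_nat_mul_pi_sq] at h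
    rw [mul_one_div, div_eq_iff (pow_ne_zero 2 (hsu k hk))]
    linear_combination -h
  have hcsc : S ^ 2 * ∑ k ∈ range N, 1 / sin (u k) ^ 2 = N ^ 2 := by
    rw [Finset.mul_sum, Finset.sum_congr rfl hfejer, Finset.sum_add_distrib, ← Finset.mul_sum,
      Finset.sum_comm]
    have : ∀ h ∈ Icc 1 H, ∑ k ∈ range N, ((N : ℝ) - h) * cos (2 * h * u k) = 0 := by
      intro h hh
      simp only [harg, ← Finset.mul_sum]
      rw [sum_cos_sub_eq_zero (hθ h) (hangle h hh).1, mul_zero]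
    rw [Finset.sum_eq_zero this]
    simp
    ring
  have hcot : S ^ 2 * ∑ k ∈ range N, cot (u k) = N * (S * C) := by
    have h1 : ∀ k ∈ range N, S ^ 2 * cot (u k) = S * C + ∑ h ∈ Icc 1 H, sin (2 * h * u k) := by
      intro k hk
      have h := sum_sin_two_mul_eq H (hsu k hk)
      rw [hNR, hNu, sin_sub_nat_mul_pi_sq, sin_mul_cos_sub_nat_mul_pi] at h
      linarith
    have h2 : ∀ h ∈ Icc 1 H, ∑ k ∈ range N, sin (2 * h * u k) = 0 := by
      intro h hh
      simp only [harg]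
      exact sum_sin_sub_eq_zero (hθ h) (hangle h hh).1 _
    rw [Finset.mul_sum, Finset.sum_congr rfl h1, Finset.sum_add_distrib, Finset.sum_comm,
      Finset.sum_eq_zero h2]
    simp
  set Z := ∑ h ∈ Icc 1 H, ((N : ℝ) - h) * (cot (π * (h / N)) * sin (2 * h * y)) with hZ
  set W := ∑ h ∈ Icc 1 H, ((N : ℝ) - h) * cos (2 * h * y) with hW
  have hcsck : S ^ 2 * ∑ k ∈ range N, k * (1 / sin (u k) ^ 2) =
      N * (N * (N - 1) / 2) - N * (Z + W) := by
    have h1 : ∀ k ∈ range N, S ^ 2 * (k * (1 / sin (u k) ^ 2)) =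
        N * k + 2 * ∑ h ∈ Icc 1 H, ((N : ℝ) - h) * (k * cos (2 * h * u k)) := by
      intro k hk
      rw [mul_left_comm, hfejer k hk, mul_add, mul_left_comm, Finset.mul_sum]
      congr 1
      · ring
      · congr 1
        exact Finset.sum_congr rfl fun h _ => by ring
    have h2 : ∀ h ∈ Icc 1 H, ∑ k ∈ range N, ((N : ℝ) - h) * (k * cos (2 * h * u k)) =
        -(N / 2) * (((N : ℝ) - h) * (cot (π * (h / N)) * sin (2 * h * y)) +
          ((N : ℝ) - h) * cos (2 * h * y)) := by
      intro h hh
      simp only [harg, ← Finset.mul_sum]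
      rw [sum_mul_cos_sub (hθ h) (hangle h hh).1]
      ring
    have h3 : ∑ k ∈ range N, (k : ℝ) = N * (N - 1) / 2 := by
      have := Finset.sum_range_id_mul_two N
      rw [show N - 1 = H by omega] at this
      have := congrArg (Nat.cast (R := ℝ)) this
      push_cast at this
      rw [← hNR] at this ⊢
      linarith
    rw [Finset.mul_sum, Finset.sum_congr rfl h1, Finset.sum_add_distrib, ← Finset.mul_sum,
      ← Finset.mul_sum, Finset.sum_comm, Finset.sum_congr rfl h2, ← Finset.mul_sum,
      Finset.sum_add_distrib, h3]
    ring
  have hsin := sum_sin_two_mul_eq H (sin_pos_of_pos_of_lt_pi hy0 hyπ).ne'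
  rw [hNR, ← hSdef, ← hCdef] at hsin
  have hmain := mul_nonneg (sq_nonneg S) (mul_cot_add_sum_nonneg hN2 hy0 hyπ hu0)
  have hsplit : ∑ k ∈ range N, (y - k * (π / N)) / sin (y - k * (π / N)) ^ 2 =
      y * ∑ k ∈ range N, 1 / sin (u k) ^ 2 -
        π / N * ∑ k ∈ range N, k * (1 / sin (u k) ^ 2) := by
    rw [Finset.mul_sum, Finset.mul_sum, ← Finset.sum_sub_distrib]
    exact Finset.sum_congr rfl fun k _ => by simp only [hu]; ring
  rw [hsplit] at hmain
  have hα : ∑ h ∈ Icc 1 H, (1 / (π * h) * (π * ((h : ℝ) / (H + 1)) * (1 - (h : ℝ) / (H + 1)) *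
        cot (π * ((h : ℝ) / (H + 1))) + (h : ℝ) / (H + 1))) * sin (2 * π * h * x) =
      Z / N ^ 2 + 1 / (π * N) * ∑ h ∈ Icc 1 H, sin (2 * h * y) := by
    rw [hZ, Finset.sum_div, Finset.mul_sum, ← Finset.sum_add_distrib]
    refine Finset.sum_congr rfl fun h hh => ?_
    have := (hangle h hh).2
    rw [hNR, show 2 * π * h * x = 2 * h * y by rw [hy]; ring]
    generalize cot (π * (h / N)) = c
    field_simp
  have hβ : ∑ h ∈ Icc 1 H, (1 / ((H : ℝ) + 1) * (1 - (h : ℝ) / (H + 1))) *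
      cos (2 * π * h * x) = W / N ^ 2 := by
    rw [hW, Finset.sum_div]
    refine Finset.sum_congr rfl fun h hh => ?_
    rw [hNR, show 2 * π * h * x = 2 * h * y by rw [hy]; ring]
    field_simp
  rw [hα, hβ, hsin, show 2 * (H : ℝ) + 2 = 2 * N by rw [← hNR]; ring]
  refine nonneg_of_mul_nonneg_right (a := π * N ^ 2) (hmain.trans_eq ?_) (by positivity)
  have e : S ^ 2 * (y * ∑ k ∈ range N, 1 / sin (u k) ^ 2 -
        π / N * ∑ k ∈ range N, k * (1 / sin (u k) ^ 2) -
      ∑ k ∈ range N, cot (u k) + N * cot y) =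
      y * N ^ 2 - π / N * (N * (N * (N - 1) / 2) - N * (Z + W)) - N * (S * C) +
        N * (S ^ 2 * cot y) := by
    linear_combination y * hcsc - π / N * hcsck - hcot
  refine e.trans ?_
  rw [hy]
  field_simp
  ring

/-- Vaaler's inequality away from the interpolation nodes. -/
lemma vaaler_of_sin_ne_zero {H : ℕ} (hH : 0 < H) {x : ℝ} (hx0 : 0 < x) (hx1 : x < 1)
    (hS : sin ((H + 1) * (π * x)) ≠ 0) :
    |x - 1 / 2 +
        ∑ h ∈ Icc 1 H,
          (1 / (π * h) * (π * ((h : ℝ) / (H + 1)) * (1 - (h : ℝ) / (H + 1)) *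
            cot (π * ((h : ℝ) / (H + 1))) + (h : ℝ) / (H + 1))) * sin (2 * π * h * x)| ≤
      (∑ h ∈ Icc 1 H,
          (1 / ((H : ℝ) + 1) * (1 - (h : ℝ) / (H + 1))) * cos (2 * π * h * x)) +
        1 / (2 * H + 2) := by
  have h1 := vaaler_lower hH hx0 hx1 hS
  have hS' : sin ((H + 1) * (π * (1 - x))) ≠ 0 := by
    have : ((H : ℝ) + 1) * (π * (1 - x)) = ((H + 1 : ℕ) : ℝ) * π - (H + 1) * (π * x) := by
      push_cast; ring
    rw [this, sin_nat_mul_pi_sub]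
    simpa using hS
  have h2 := vaaler_lower hH (sub_pos.2 hx1) (by linarith : 1 - x < 1) hS'
  have hs : ∀ h : ℕ, sin (2 * π * h * (1 - x)) = -sin (2 * π * h * x) := fun h => by
    rw [show 2 * π * h * (1 - x) = h * (2 * π) - 2 * π * h * x by ring, sin_nat_mul_two_pi_sub]
  have hc : ∀ h : ℕ, cos (2 * π * h * (1 - x)) = cos (2 * π * h * x) := fun h => by
    rw [show 2 * π * h * (1 - x) = h * (2 * π) - 2 * π * h * x by ring, cos_nat_mul_two_pi_sub]
  simp only [hs, hc, mul_neg, Finset.sum_neg_distrib] at h2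
  rw [abs_le]
  constructor <;> linarith

/-- Vaaler's approximation of the sawtooth function by trigonometric polynomials. -/
theorem vaaler_approximation (w : ℝ) (H : ℕ) (hH : 0 < H) :
    |((w - ⌊w⌋ - 1/2) +
        ∑ h ∈ Finset.Icc 1 H,
          (1 / (Real.pi * h) *
              (Real.pi * ((h : ℝ)/(H+1)) * (1 - (h : ℝ)/(H+1)) * Real.cot (Real.pi * ((h : ℝ)/(H+1)))
                + (h : ℝ)/(H+1))) *
            Real.sin (2 * Real.pi * h * w))|
      ≤ (∑ h ∈ Finset.Icc 1 H,
          (1 / ((H : ℝ)+1) * (1 - (h : ℝ)/(H+1))) * Real.cos (2 * Real.pi * h * w))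
        + 1 / (2 * H + 2) := by
  obtain ⟨x, hx⟩ : ∃ x, x = w - ⌊w⌋ := ⟨_, rfl⟩
  have hx0 : 0 ≤ x := by rw [hx]; linarith [Int.floor_le w]
  have hx1 : x < 1 := by rw [hx]; linarith [Int.lt_floor_add_one w]
  have harg : ∀ h : ℕ, 2 * π * h * w = 2 * π * h * x + ((h * ⌊w⌋ : ℤ) : ℝ) * (2 * π) := fun h => by
    rw [hx]; push_cast; ring
  simp only [harg, sin_add_int_mul_two_pi, cos_add_int_mul_two_pi]
  rw [← hx]
  have hN : (0 : ℝ) < H + 1 := by positivity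
  -- right of `x`, all points close enough to `x` avoid the nodes `k / (H + 1)`
  have hev : ∀ᶠ t in nhdsWithin x (Set.Ioi x),
      0 < t ∧ t < 1 ∧ sin ((H + 1) * (π * t)) ≠ 0 := by
    set m : ℤ := ⌊(H + 1) * x⌋ with hm
    have hxm : x < (m + 1) / (H + 1) := by
      rw [lt_div_iff₀ hN, mul_comm]
      exact Int.lt_floor_add_one _
    filter_upwards [Ioo_mem_nhdsGT hx1, Ioo_mem_nhdsGT hxm] with t ht1 ht2
    refine ⟨hx0.trans_lt ht1.1, ht1.2, fun h0 => ?_⟩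
    obtain ⟨n, hn⟩ := sin_eq_zero_iff.1 h0
    have hn' : (n : ℝ) = (H + 1) * t := by
      apply mul_right_cancel₀ pi_ne_zero
      rw [hn]; ring
    have h1 : (m : ℝ) < n := by
      rw [hn']
      exact (Int.floor_le _).trans_lt (mul_lt_mul_of_pos_left ht2.1 hN)
    have h2 : (n : ℝ) < m + 1 := by
      have := (lt_div_iff₀ hN).1 ht2.2
      rw [hn']; linarith
    have h1' : m < n := by exact_mod_cast h1
    have h2' : n < m + 1 := by exact_mod_cast h2
    omega
  refine le_of_tendsto_of_tendsto (b := nhdsWithin x (Set.Ioi x))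
    (Continuous.tendsto ?_ x |>.mono_left nhdsWithin_le_nhds)
    (Continuous.tendsto ?_ x |>.mono_left nhdsWithin_le_nhds)
    (hev.mono fun t ht => vaaler_of_sin_ne_zero hH ht.1 ht.2.1 ht.2.2)
  · fun_prop
  · fun_prop
end

section
/- (Quantitative Kronecker theorem via discrepancy.) There is an absolute constant c > 0 with the following property. Let s ≥ 2 be an integer and a = (a_1, …, a_s) ∈ ℝ^s such that 1, a_1, …, a_s are linearly independent over ℤ. Suppose φ : ℝ⁺ → ℝ⁺ is a strictly increasing bijection such that φ(t)/t is monotonically increasing and ‖h · a‖ ≥ 1/φ(|h|_∞) for all h ∈ ℤ^s \ {0}, where ‖·‖ denotes the distance to the nearest integer and |h|_∞ = max_i |h_i|. Then for all positive integers N_0 and N with φ^{−1}(N) ≥ e, the discrepancy modulo 1 of the sequence (n a)_{n = N_0+1}^{N_0+N} satisfies D_{N_0,N}(n a) ≤ c^s · s! · (log N · log φ^{−1}(N)) / φ^{−1}(N), where φ^{−1} is the inverse function of φ. -/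
/-- The additive character `x ↦ exp (2πix)`. -/
noncomputable def addExp (x : ℝ) : ℂ := Complex.exp (Complex.I * ((2 * Real.pi * x : ℝ) : ℂ))

lemma addExp_zero : addExp 0 = 1 := by simp [addExp]

lemma addExp_add (x y : ℝ) : addExp (x + y) = addExp x * addExp y := by
  rw [addExp, addExp, addExp, ← Complex.exp_add]
  congr 1
  push_cast
  ring

lemma norm_addExp (x : ℝ) : ‖addExp x‖ = 1 := by
  rw [addExp, mul_comm, Complex.norm_exp_ofReal_mul_I]

lemma addExp_nat_mul (n : ℕ) (x : ℝ) : addExp (n * x) = addExp x ^ n := by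
  rw [addExp, addExp, ← Complex.exp_nat_mul]
  congr 1
  push_cast
  ring

lemma addExp_int (n : ℤ) : addExp n = 1 := by
  rw [addExp, Complex.exp_eq_one_iff]
  exact ⟨n, by push_cast; ring⟩

lemma addExp_sum {ι : Type*} (s : Finset ι) (f : ι → ℝ) :
    addExp (∑ i ∈ s, f i) = ∏ i ∈ s, addExp (f i) := by
  rw [addExp, Finset.mul_sum, Complex.ofReal_sum, Finset.mul_sum, Complex.exp_sum]
  rfl

lemma addExp_fract (x : ℝ) : addExp (Int.fract x) = addExp x := by
  conv_rhs => rw [← Int.fract_add_floor x, addExp_add, addExp_int, mul_one]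

lemma norm_addExp_sub_one_le (x : ℝ) : ‖addExp x - 1‖ ≤ 2 * Real.pi * |x| := by
  refine (Real.norm_exp_I_mul_ofReal_sub_one_le).trans_eq ?_
  rw [Real.norm_eq_abs, abs_mul, abs_of_pos Real.two_pi_pos]

lemma four_mul_dist_round_le_norm_addExp_sub_one (x : ℝ) :
    4 * |x - round x| ≤ ‖addExp x - 1‖ := by
  have h : addExp x = addExp (x - round x) := by
    conv_lhs => rw [← sub_add_cancel x (round x : ℝ), addExp_add, addExp_int, mul_one]
  have hr := abs_sub_round x
  rw [h, addExp, Complex.norm_exp_I_mul_ofReal_sub_one, Real.norm_eq_abs, abs_mul, abs_two]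
  generalize x - round x = y at hr ⊢
  have hpi := Real.pi_pos
  have h1 : |2 * Real.pi * y / 2| = Real.pi * |y| := by
    rw [mul_assoc, mul_div_cancel_left₀ _ two_ne_zero, abs_mul, abs_of_pos hpi]
  have := Real.mul_abs_le_abs_sin (x := 2 * Real.pi * y / 2) (by rw [h1]; nlinarith)
  rw [h1] at this
  have h2 : 2 / Real.pi * (Real.pi * |y|) = 2 * |y| := by field_simp
  linarith

lemma norm_sum_addExp_mul_dist_round_le (N₀ N : ℕ) (θ : ℝ) :
    ‖∑ n ∈ Finset.Ioc N₀ (N₀ + N), addExp (n * θ)‖ * |θ - round θ| ≤ 1 := by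
  have hgeom : (∑ n ∈ Finset.Ioc N₀ (N₀ + N), addExp (n * θ)) * (addExp θ - 1)
      = addExp θ ^ (N₀ + 1) * (addExp θ ^ N - 1) := by
    have : ∑ n ∈ Finset.Ioc N₀ (N₀ + N), addExp (n * θ)
        = addExp θ ^ (N₀ + 1) * ∑ n ∈ Finset.range N, addExp θ ^ n := by
      rw [Finset.mul_sum, ← Finset.Ico_add_one_add_one_eq_Ioc, Finset.sum_Ico_eq_sum_range]
      rw [show N₀ + N + 1 - (N₀ + 1) = N by omega]
      exact Finset.sum_congr rfl fun n _ => by rw [addExp_nat_mul, pow_add]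
    rw [this, mul_assoc, geom_sum_mul]
  have hnorm := congrArg norm hgeom
  rw [norm_mul, norm_mul, norm_pow, norm_addExp, one_pow, one_mul] at hnorm
  have h2 : ‖addExp θ ^ N - 1‖ ≤ 2 := by
    refine (norm_sub_le _ _).trans ?_
    rw [norm_pow, norm_addExp]
    norm_num
  have h4 := mul_le_mul_of_nonneg_left (four_mul_dist_round_le_norm_addExp_sub_one θ)
    (norm_nonneg (∑ n ∈ Finset.Ioc N₀ (N₀ + N), addExp (n * θ)))
  nlinarith

lemma norm_sum_addExp_le (N₀ N : ℕ) (θ : ℝ) :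
    ‖∑ n ∈ Finset.Ioc N₀ (N₀ + N), addExp (n * θ)‖ ≤ N := by
  refine (norm_sum_le _ _).trans ?_
  simp [norm_addExp]

lemma hasSum_inv_sq_mul_addExp (x : ℝ) :
    HasSum (fun n : ℤ => 1 / (n : ℂ) ^ 2 * addExp (n * x))
      ((2 * Real.pi ^ 2 * bernoulliFun 2 (Int.fract x) : ℝ) : ℂ) := by
  have h := hasSum_one_div_pow_mul_fourier_mul_bernoulliFun (k := 2) le_rfl
    (x := Int.fract x) ⟨Int.fract_nonneg x, (Int.fract_lt_one x).le⟩
  convert h using 1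
  · funext n
    congr 1
    rw [fourier_coe_apply, ← mul_one (addExp _), ← addExp_int (-(n * ⌊x⌋)), ← addExp_add, addExp]
    congr 1
    have : (n * x + (-(n * ⌊x⌋) : ℤ) : ℝ) = n * Int.fract x := by
      rw [Int.fract]; push_cast; ring
    rw [this]
    push_cast
    ring
  · simp only [Nat.factorial]
    push_cast
    rw [mul_pow, mul_pow, Complex.I_sq]
    ring

/-- The average of the sawtooth function `x ↦ {x} - 1/2` over `[x, x + δ]`. -/
noncomputable def smoothSaw (δ x : ℝ) : ℝ :=
  (bernoulliFun 2 (Int.fract (x + δ)) - bernoulliFun 2 (Int.fract x)) / (2 * δ)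

lemma fract_add_eq_or {δ : ℝ} (h0 : 0 < δ) (h1 : δ < 1) (x : ℝ) :
    (Int.fract (x + δ) = Int.fract x + δ ∧ Int.fract x + δ < 1) ∨
      (Int.fract (x + δ) = Int.fract x + δ - 1 ∧ 1 ≤ Int.fract x + δ) := by
  have hx := Int.fract_nonneg x
  have hx1 := Int.fract_lt_one x
  have hf := Int.self_sub_floor x
  rcases lt_or_ge (Int.fract x + δ) 1 with h | h
  · refine Or.inl ⟨?_, h⟩
    rw [Int.fract_eq_iff]
    exact ⟨by linarith, h, ⌊x⌋, by linarith⟩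
  · refine Or.inr ⟨?_, h⟩
    rw [Int.fract_eq_iff]
    exact ⟨by linarith, by linarith, ⌊x⌋ + 1, by push_cast; linarith⟩

lemma smoothSaw_le {δ : ℝ} (h0 : 0 < δ) (h1 : δ < 1) (x : ℝ) :
    smoothSaw δ x ≤ Int.fract x - 1 / 2 + δ / 2 := by
  rw [smoothSaw, bernoulliFun_two, bernoulliFun_two, div_le_iff₀ (by linarith)]
  rcases fract_add_eq_or h0 h1 x with ⟨h, h'⟩ | ⟨h, h'⟩ <;> rw [h] <;> nlinarith

lemma le_smoothSaw {δ : ℝ} (h0 : 0 < δ) (h1 : δ < 1) (x : ℝ) :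
    Int.fract (x + δ) - 1 / 2 - δ / 2 ≤ smoothSaw δ x := by
  have hx1 := Int.fract_lt_one x
  rw [smoothSaw, bernoulliFun_two, bernoulliFun_two, le_div_iff₀ (by linarith)]
  rcases fract_add_eq_or h0 h1 x with ⟨h, h'⟩ | ⟨h, h'⟩ <;> rw [h] <;> nlinarith

lemma hasSum_smoothSaw {δ : ℝ} (h0 : 0 < δ) (x : ℝ) :
    HasSum (fun n : ℤ => 1 / (n : ℂ) ^ 2 * (addExp (n * (x + δ)) - addExp (n * x))
      * ((1 / (4 * Real.pi ^ 2 * δ) : ℝ) : ℂ)) (smoothSaw δ x : ℂ) := by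
  convert! ((hasSum_inv_sq_mul_addExp (x + δ)).sub (hasSum_inv_sq_mul_addExp x)).mul_right
    ((1 / (4 * Real.pi ^ 2 * δ) : ℝ) : ℂ) using 1
  · funext n
    ring
  · have := Real.pi_pos
    rw [smoothSaw, ← Complex.ofReal_sub, ← Complex.ofReal_mul]
    congr 1
    field_simp
    ring

/-- A smooth majorant of the arc indicator `x ↦ ⌊x - α⌋ - ⌊x - β⌋`, with its Fourier expansion. -/
lemma exists_arc_majorant {δ : ℝ} (h0 : 0 < δ) (h1 : δ < 1) (α β : ℝ) :
    ∃ (c : ℤ → ℂ) (f : ℝ → ℝ), c 0 = ((β - α + δ : ℝ) : ℂ) ∧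
      (∀ h : ℤ, h ≠ 0 → ‖c h‖ ≤ 1 / |(h : ℝ)| ∧ ‖c h‖ ≤ 1 / (δ * (h : ℝ) ^ 2)) ∧
      (∀ x, HasSum (fun h : ℤ => c h * addExp (h * x)) (f x : ℂ)) ∧
      ∀ x, (⌊x - α⌋ - ⌊x - β⌋ : ℝ) ≤ f x := by
  have hpi := Real.pi_pos
  have hpi3 := Real.pi_gt_three
  set g : ℤ → ℂ := fun h => 1 / (h : ℂ) ^ 2 * ((addExp (h * (-β)) - addExp (h * (-β - δ)))
    - (addExp (h * (-α + δ)) - addExp (h * -α))) * ((1 / (4 * Real.pi ^ 2 * δ) : ℝ) : ℂ) with hg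
  have hg0 : g 0 = 0 := by simp [hg]
  refine ⟨fun h => g h + if h = 0 then ((β - α + δ : ℝ) : ℂ) else 0,
    fun x => smoothSaw δ (x - β - δ) - smoothSaw δ (x - α) + (β - α + δ), by simp [hg0], ?_, ?_, ?_⟩
  · intro h hh
    have hR : 0 < |(h : ℝ)| := by positivity
    have hn : ‖g h‖ = 1 / (h : ℝ) ^ 2 * ‖(addExp (h * (-β)) - addExp (h * (-β - δ)))
        - (addExp (h * (-α + δ)) - addExp (h * -α))‖ * (1 / (4 * Real.pi ^ 2 * δ)) := by
      rw [hg]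
      simp only [norm_mul, norm_div, norm_one, norm_pow, Complex.norm_intCast, Complex.norm_real,
        Real.norm_eq_abs, sq_abs, abs_of_pos h0, abs_of_pos hpi]
      norm_num
    have hshift : ∀ y : ℝ, ‖addExp (h * (y + δ)) - addExp (h * y)‖ ≤ 2 * Real.pi * (|(h : ℝ)| * δ)
        ∧ ‖addExp (h * (y + δ)) - addExp (h * y)‖ ≤ 2 := by
      intro y
      constructor
      · rw [mul_add, addExp_add, ← mul_sub_one, norm_mul, norm_addExp, one_mul]
        refine (norm_addExp_sub_one_le _).trans_eq ?_
        rw [abs_mul, abs_of_pos h0]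
      · refine (norm_sub_le _ _).trans ?_
        rw [norm_addExp, norm_addExp]
        norm_num
    have hb := hshift (-β - δ)
    rw [sub_add_cancel] at hb
    have ha := hshift (-α)
    have htri := norm_sub_le (addExp (h * (-β)) - addExp (h * (-β - δ)))
      (addExp (h * (-α + δ)) - addExp (h * -α))
    have hsq : (h : ℝ) ^ 2 = |(h : ℝ)| ^ 2 := (sq_abs _).symm
    simp only [hh, if_false, add_zero, hn, hsq]
    constructor
    · calc _ ≤ 1 / |(h : ℝ)| ^ 2 * (4 * Real.pi * (|(h : ℝ)| * δ)) * (1 / (4 * Real.pi ^ 2 * δ)) := by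
            gcongr
            linarith
        _ = (1 / |(h : ℝ)|) * (1 / Real.pi) := by field_simp
        _ ≤ (1 / |(h : ℝ)|) * 1 := by
            gcongr
            rw [div_le_one hpi]
            linarith
        _ = _ := mul_one _
    · calc _ ≤ 1 / |(h : ℝ)| ^ 2 * 4 * (1 / (4 * Real.pi ^ 2 * δ)) := by
            gcongr
            linarith
        _ = (1 / (δ * |(h : ℝ)| ^ 2)) * (1 / Real.pi ^ 2) := by field_simp
        _ ≤ (1 / (δ * |(h : ℝ)| ^ 2)) * 1 := by
            gcongr
            rw [div_le_one (by positivity)]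
            nlinarith
        _ = _ := mul_one _
  · intro x
    have hc : HasSum (fun h : ℤ => (if h = 0 then ((β - α + δ : ℝ) : ℂ) else 0) * addExp (h * x))
        ((β - α + δ : ℝ) : ℂ) := by
      convert hasSum_single (0 : ℤ) _ using 1
      · simp [addExp_zero]
      · intro h hh
        simp [hh]
    convert! ((hasSum_smoothSaw h0 (x - β - δ)).sub (hasSum_smoothSaw h0 (x - α))).add hc using 1
    · funext h
      rw [add_mul, hg]
      congr 1
      have e1 : (h : ℝ) * (x - β - δ + δ) = h * -β + h * x := by ring
      have e2 : (h : ℝ) * (x - β - δ) = h * (-β - δ) + h * x := by ring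
      have e3 : (h : ℝ) * (x - α + δ) = h * (-α + δ) + h * x := by ring
      have e4 : (h : ℝ) * (x - α) = h * -α + h * x := by ring
      rw [e1, e2, e3, e4]
      simp only [addExp_add]
      ring
    · push_cast
      ring
  · intro x
    have hu := le_smoothSaw h0 h1 (x - β - δ)
    have hl := smoothSaw_le h0 h1 (x - α)
    rw [sub_add_cancel] at hu
    have h3 := Int.self_sub_floor (x - β)
    have h4 := Int.self_sub_floor (x - α)
    linarith

lemma sum_le_mul_harmonic {ι : Type*} (X : Finset ι) (k : ι → ℕ) (K : ℕ)
    (hinj : Set.InjOn k X) (hk : ∀ i ∈ X, k i < K) (F : ι → ℝ) {C : ℝ} (hC : 0 ≤ C)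
    (hF : ∀ i ∈ X, F i ≤ C / (k i + 1)) : ∑ i ∈ X, F i ≤ C * (harmonic K : ℝ) := by
  classical
  calc ∑ i ∈ X, F i ≤ ∑ i ∈ X, C / (k i + 1) := Finset.sum_le_sum hF
    _ = ∑ j ∈ X.image k, C / ((j : ℝ) + 1) :=
        (Finset.sum_image (f := fun j : ℕ => C / ((j : ℝ) + 1)) hinj).symm
    _ ≤ ∑ j ∈ Finset.range K, C / ((j : ℝ) + 1) := by
        refine Finset.sum_le_sum_of_subset_of_nonneg ?_ fun j _ _ => by positivity
        intro j hj
        obtain ⟨i, hi, rfl⟩ := Finset.mem_image.1 hj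
        exact Finset.mem_range.2 (hk i hi)
    _ = C * (harmonic K : ℝ) := by
        rw [harmonic, Rat.cast_sum, Finset.mul_sum]
        refine Finset.sum_congr rfl fun j _ => ?_
        push_cast
        rw [div_eq_mul_inv]

/-- If the `y i` are `1/M`-separated modulo `1`, a sum of terms bounded by `M` and `1/‖y i‖` is
`O(M (1 + log M))`. -/
lemma sum_le_of_separated {ι : Type*} (X : Finset ι) (y F : ι → ℝ) {M : ℝ} (hM : 1 ≤ M)
    (hsep : ∀ i ∈ X, ∀ j ∈ X, i ≠ j → 1 / M ≤ |(y i - y j) - round (y i - y j)|)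
    (hF : ∀ i ∈ X, F i ≤ M) (hF' : ∀ i ∈ X, F i * |y i - round (y i)| ≤ 1) :
    ∑ i ∈ X, F i ≤ 4 * M * (2 + Real.log M) := by
  classical
  have hM0 : 0 < M := by linarith
  set r : ι → ℝ := fun i => y i - round (y i) with hr
  set k : ι → ℕ := fun i => ⌊M * |r i|⌋₊ with hk
  have hk1 : ∀ i, (k i : ℝ) ≤ M * |r i| := fun i => Nat.floor_le (by positivity)
  have hk2 : ∀ i, M * |r i| < k i + 1 := fun i => Nat.lt_floor_add_one _
  have hnear : ∀ i ∈ X, ∀ j ∈ X, |r i - r j| < 1 / M → i = j := by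
    intro i hi j hj h
    by_contra hij
    have h1 := hsep i hi j hj hij
    have h2 := round_le (y i - y j) (round (y i) - round (y j))
    have h3 : y i - y j - ((round (y i) - round (y j) : ℤ) : ℝ) = r i - r j := by
      rw [hr]; push_cast; ring
    rw [h3] at h2
    linarith
  have habs : ∀ i j, k i = k j → |(|r i| - |r j|)| < 1 / M := by
    intro i j hij
    have e : (k i : ℝ) = k j := by rw [hij]
    rw [lt_div_iff₀ hM0]
    rcases abs_cases (|r i| - |r j|) with ⟨h, _⟩ | ⟨h, _⟩ <;> rw [h] <;>
      linarith [hk1 i, hk1 j, hk2 i, hk2 j]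
  have hlt : ∀ i ∈ X, k i < ⌊M⌋₊ + 1 := by
    intro i _
    refine Nat.lt_succ_of_le (Nat.floor_le_floor ?_)
    have := abs_sub_round (y i)
    change M * |y i - round (y i)| ≤ M
    nlinarith
  have hFk : ∀ i ∈ X, F i ≤ 2 * M / (k i + 1) := by
    intro i hi
    rw [le_div_iff₀ (by positivity)]
    have h1 := hF i hi
    have h2 : F i * |r i| ≤ 1 := hF' i hi
    rcases le_or_gt (F i) 0 with h0 | h0
    · have : F i * ((k i : ℝ) + 1) ≤ 0 := mul_nonpos_of_nonpos_of_nonneg h0 (by positivity)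
      linarith
    · have h3 := mul_le_mul_of_nonneg_left (hk1 i) h0.le
      nlinarith
  have hharm : (harmonic (⌊M⌋₊ + 1) : ℝ) ≤ 2 + Real.log M := by
    refine (harmonic_le_one_add_log _).trans ?_
    have h1 : ((⌊M⌋₊ + 1 : ℕ) : ℝ) ≤ 2 * M := by
      have := Nat.floor_le hM0.le
      push_cast
      linarith
    have h2 := Real.log_le_log (by positivity) h1
    rw [Real.log_mul two_ne_zero hM0.ne'] at h2
    have := Real.log_two_lt_d9
    linarith
  have hpos : ∑ i ∈ X with 0 ≤ r i, F i ≤ 2 * M * (harmonic (⌊M⌋₊ + 1) : ℝ) := by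
    refine sum_le_mul_harmonic _ k _ ?_ (fun i hi => hlt i (Finset.mem_filter.1 hi).1) F
      (by positivity) (fun i hi => hFk i (Finset.mem_filter.1 hi).1)
    intro i hi j hj hij
    obtain ⟨hi, hi'⟩ := Finset.mem_filter.1 hi
    obtain ⟨hj, hj'⟩ := Finset.mem_filter.1 hj
    refine hnear i hi j hj ?_
    have := habs i j hij
    rwa [abs_of_nonneg hi', abs_of_nonneg hj'] at this
  have hneg : ∑ i ∈ X with ¬ 0 ≤ r i, F i ≤ 2 * M * (harmonic (⌊M⌋₊ + 1) : ℝ) := by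
    refine sum_le_mul_harmonic _ k _ ?_ (fun i hi => hlt i (Finset.mem_filter.1 hi).1) F
      (by positivity) (fun i hi => hFk i (Finset.mem_filter.1 hi).1)
    intro i hi j hj hij
    obtain ⟨hi, hi'⟩ := Finset.mem_filter.1 hi
    obtain ⟨hj, hj'⟩ := Finset.mem_filter.1 hj
    refine hnear i hi j hj ?_
    have := habs i j hij
    rw [abs_of_neg (not_le.1 hi'), abs_of_neg (not_le.1 hj')] at this
    rwa [abs_sub_comm, show r j - r i = -r i - -r j by ring]
  rw [← Finset.sum_filter_add_sum_filter_not X (fun i => 0 ≤ r i)]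
  nlinarith

open Classical in
/-- Summation over a cover of the lattice by boxes: weights dominated coordinatewise by weighted
cells turn box estimates into an estimate for the weighted sum. -/
lemma sum_prod_mul_le_of_cells {s : ℕ} {κ : Type*} (H : Finset (Fin s → ℤ)) (cells : Finset κ)
    (S : κ → ℤ → Prop) (v L : κ → ℝ) (hv : ∀ C, 0 ≤ v C) {B : ℝ}
    (w : Fin s → ℤ → ℝ) (hw0 : ∀ i n, 0 ≤ w i n) (m : (Fin s → ℤ) → ℝ) (hm : ∀ h, 0 ≤ m h)
    (hw : ∀ i, ∀ h ∈ H, w i (h i) ≤ ∑ C ∈ cells, v C * if S C (h i) then 1 else 0)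
    (hbox : ∀ Q : Fin s → κ, (∀ i, Q i ∈ cells) →
      ∑ h ∈ H with ∀ i, S (Q i) (h i), m h ≤ B * ∑ i, L (Q i)) :
    ∑ h ∈ H, (∏ i, w i (h i)) * m h
      ≤ B * (s * ((∑ C ∈ cells, v C * L C) * (∑ C ∈ cells, v C) ^ (s - 1))) := by
  calc ∑ h ∈ H, (∏ i, w i (h i)) * m h
      ≤ ∑ h ∈ H, (∏ i, ∑ C ∈ cells, v C * if S C (h i) then 1 else 0) * m h := by
        refine Finset.sum_le_sum fun h hh => mul_le_mul_of_nonneg_right ?_ (hm h)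
        exact Finset.prod_le_prod (fun i _ => hw0 i _) fun i _ => hw i h hh
    _ = ∑ Q ∈ Fintype.piFinset fun _ : Fin s => cells,
          (∏ i, v (Q i)) * ∑ h ∈ H with ∀ i, S (Q i) (h i), m h := by
        simp_rw [Finset.prod_univ_sum, Finset.sum_mul]
        rw [Finset.sum_comm]
        refine Finset.sum_congr rfl fun Q _ => ?_
        rw [Finset.sum_filter, Finset.mul_sum]
        refine Finset.sum_congr rfl fun h _ => ?_
        rw [Finset.prod_mul_distrib, Finset.prod_ite_zero]
        simp
    _ ≤ ∑ Q ∈ Fintype.piFinset fun _ : Fin s => cells,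
          (∏ i, v (Q i)) * (B * ∑ i, L (Q i)) := by
        refine Finset.sum_le_sum fun Q hQ => mul_le_mul_of_nonneg_left ?_
          (Finset.prod_nonneg fun i _ => hv _)
        exact hbox Q (Fintype.mem_piFinset.1 hQ)
    _ = B * ∑ i, ∑ Q ∈ Fintype.piFinset fun _ : Fin s => cells,
          ∏ j, (v (Q j) * if j = i then L (Q j) else 1) := by
        rw [Finset.sum_comm, Finset.mul_sum]
        refine Finset.sum_congr rfl fun Q _ => ?_
        rw [mul_left_comm, Finset.mul_sum]
        congr 1
        refine Finset.sum_congr rfl fun i _ => ?_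
        rw [Finset.prod_mul_distrib]
        simp
    _ = B * ∑ i : Fin s, ((∑ C ∈ cells, v C * L C) * (∑ C ∈ cells, v C) ^ (s - 1)) := by
        congr 1
        refine Finset.sum_congr rfl fun i _ => ?_
        rw [← Finset.prod_univ_sum (fun _ : Fin s => cells)
          (fun j C => v C * if j = i then L C else 1), ← Finset.mul_prod_erase _ _ (Finset.mem_univ i)]
        congr 1
        · simp
        · rw [Finset.prod_congr rfl (g := fun _ => ∑ C ∈ cells, v C), Finset.prod_const,
            Finset.card_erase_of_mem (Finset.mem_univ i), Finset.card_univ, Fintype.card_fin]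
          intro j hj
          simp [Finset.ne_of_mem_erase hj]
    _ = _ := by simp

/-- Cells covering `ℤ`: centred dyadic intervals, and the translates of `[0, 2 ^ J)`. -/
def latticeCell (J : ℕ) : ℕ ⊕ ℤ → ℤ → Prop :=
  Sum.elim (fun j n => |n| < 2 ^ j) (fun m n => n / 2 ^ J = m)

/-- The weight attached to a cell. -/
noncomputable def cellWeight (J : ℕ) : ℕ ⊕ ℤ → ℝ :=
  Sum.elim (fun j => 2 * (1 / 2) ^ j) (fun m => 32 / (2 ^ J * (1 + (m : ℝ) ^ 2)))

/-- A bound for the length of a cell. -/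
def cellLength (J : ℕ) : ℕ ⊕ ℤ → ℝ :=
  Sum.elim (fun j => 2 ^ (j + 1)) (fun _ => 2 ^ J)

lemma cellWeight_nonneg (J : ℕ) (C : ℕ ⊕ ℤ) : 0 ≤ cellWeight J C := by
  rcases C with j | m <;> simp only [cellWeight, Sum.elim_inl, Sum.elim_inr] <;> positivity

lemma cellLength_pos (J : ℕ) (C : ℕ ⊕ ℤ) : 0 < cellLength J C := by
  rcases C with j | m <;> simp only [cellLength, Sum.elim_inl, Sum.elim_inr] <;> positivity

open Classical in
/-- The cells that meet the finite set `A`. -/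
noncomputable def latticeCells (J : ℕ) (A : Finset ℤ) : Finset (ℕ ⊕ ℤ) :=
  (Finset.range J).disjSum (A.image fun n => n / 2 ^ J)

lemma summable_one_div_one_add_sq : Summable fun m : ℤ => 1 / (1 + (m : ℝ) ^ 2) := by
  have h1 : Summable fun m : ℤ => 1 / (m : ℝ) ^ 2 :=
    Real.summable_one_div_int_pow.2 one_lt_two
  refine Summable.of_norm_bounded_eventually h1 ?_
  filter_upwards [(Set.finite_singleton (0 : ℤ)).compl_mem_cofinite] with m hm
  have hm0 : (m : ℝ) ≠ 0 := by simpa using hm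
  rw [Real.norm_of_nonneg (by positivity)]
  exact one_div_le_one_div_of_le (by positivity) (by linarith)

lemma sum_cellWeight_le (J : ℕ) (A : Finset ℤ) :
    ∑ C ∈ latticeCells J A, cellWeight J C ≤ 4 + 32 * ∑' m : ℤ, 1 / (1 + (m : ℝ) ^ 2) := by
  rw [latticeCells, Finset.sum_disjSum]
  refine add_le_add ?_ ?_
  · simp only [cellWeight, Sum.elim_inl]
    rw [← Finset.mul_sum]
    linarith [sum_geometric_two_le J]
  · refine le_trans ?_ (mul_le_mul_of_nonneg_left
      (summable_one_div_one_add_sq.sum_le_tsum (A.image fun n => n / 2 ^ J)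
        fun m _ => by positivity) (by norm_num))
    rw [Finset.mul_sum]
    refine Finset.sum_le_sum fun m _ => ?_
    simp only [cellWeight, Sum.elim_inr]
    rw [mul_one_div]
    gcongr
    exact le_mul_of_one_le_left (by positivity) (one_le_pow₀ one_le_two)

lemma sum_cellWeight_mul_cellLength_le (J : ℕ) (A : Finset ℤ) :
    ∑ C ∈ latticeCells J A, cellWeight J C * cellLength J C
      ≤ 4 * J + 32 * ∑' m : ℤ, 1 / (1 + (m : ℝ) ^ 2) := by
  rw [latticeCells, Finset.sum_disjSum]
  refine add_le_add (le_of_eq ?_) ?_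
  · rw [Finset.sum_congr rfl (g := fun _ => (4 : ℝ))]
    · simp [mul_comm]
    · intro j _
      simp only [cellWeight, cellLength, Sum.elim_inl]
      rw [pow_succ, mul_assoc, ← mul_assoc (_ ^ _), ← mul_pow]
      norm_num
  · refine le_trans (le_of_eq ?_) (mul_le_mul_of_nonneg_left
      (summable_one_div_one_add_sq.sum_le_tsum (A.image fun n => n / 2 ^ J)
        fun m _ => by positivity) (by norm_num))
    rw [Finset.mul_sum]
    refine Finset.sum_congr rfl fun m _ => ?_
    simp only [cellWeight, cellLength, Sum.elim_inr]
    field_simp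

open Classical in
lemma le_sum_cellWeight {J : ℕ} (hJ : 1 ≤ J) {T : ℝ} (hT : T ≤ 2 * 2 ^ J) {A : Finset ℤ} {n : ℤ}
    (hn : n ∈ A) {x : ℝ} (hx0 : n = 0 → x ≤ 2)
    (hx : n ≠ 0 → x ≤ 1 / |(n : ℝ)| ∧ x ≤ T / (n : ℝ) ^ 2) :
    x ≤ ∑ C ∈ latticeCells J A, cellWeight J C * if latticeCell J C n then 1 else 0 := by
  have key : ∀ C ∈ latticeCells J A, latticeCell J C n → x ≤ cellWeight J C →
      x ≤ ∑ C ∈ latticeCells J A, cellWeight J C * if latticeCell J C n then 1 else 0 := by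
    intro C hC hcell hxC
    refine hxC.trans ?_
    have := Finset.single_le_sum (s := latticeCells J A)
      (f := fun C => cellWeight J C * if latticeCell J C n then 1 else 0)
      (fun D _ => mul_nonneg (cellWeight_nonneg J D) (by split_ifs <;> norm_num)) hC
    simpa [hcell] using this
  by_cases h0 : n = 0
  · refine key (Sum.inl 0) ?_ ?_ ?_
    · simpa [latticeCells] using Nat.pos_of_ne_zero (by omega)
    · simp [latticeCell, h0]
    · simpa [cellWeight] using hx0 h0
  obtain ⟨hx1, hx2⟩ := hx h0
  have hlog := Nat.pow_log_le_self 2 (Int.natAbs_ne_zero.2 h0)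
  have hlog' := Nat.lt_pow_succ_log_self one_lt_two n.natAbs
  set j := Nat.log 2 n.natAbs with hj
  have hR : ((2 ^ j : ℕ) : ℝ) ≤ |(n : ℝ)| := by
    rw [← Int.cast_abs, Int.abs_eq_natAbs, Int.cast_natCast]
    exact_mod_cast hlog
  push_cast at hR
  by_cases hjJ : j + 1 < J
  · refine key (Sum.inl (j + 1)) ?_ ?_ ?_
    · simpa [latticeCells] using hjJ
    · simp only [latticeCell, Sum.elim_inl, Int.abs_eq_natAbs]
      exact_mod_cast hlog'
    · refine hx1.trans ?_
      simp only [cellWeight, Sum.elim_inl]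
      refine (one_div_le_one_div_of_le (by positivity) hR).trans_eq ?_
      rw [pow_succ, one_div_pow]
      ring
  · refine key (Sum.inr (n / 2 ^ J)) ?_ ?_ ?_
    · simp only [latticeCells, Finset.inr_mem_disjSum]
      exact Finset.mem_image_of_mem _ hn
    · simp [latticeCell]
    · refine hx2.trans ?_
      simp only [cellWeight, Sum.elim_inr]
      have hP : (2 : ℝ) ^ J ≤ 2 * |(n : ℝ)| := by
        calc (2 : ℝ) ^ J ≤ 2 ^ (j + 1) := pow_le_pow_right₀ one_le_two (by omega)
          _ = 2 * 2 ^ j := by ring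
          _ ≤ _ := by linarith
      have hnpos : 0 < |(n : ℝ)| := by positivity
      have hd1 : ((n / 2 ^ J : ℤ) : ℝ) * 2 ^ J ≤ n := by
        exact_mod_cast Int.ediv_mul_le n (by positivity)
      have hd2 : (n : ℝ) < (((n / 2 ^ J : ℤ) : ℝ) + 1) * 2 ^ J := by
        exact_mod_cast Int.lt_ediv_add_one_mul_self n (by positivity)
      generalize n / 2 ^ J = m at *
      have hPpos : (0 : ℝ) < 2 ^ J := by positivity
      generalize (2 : ℝ) ^ J = P at *
      have hm : |(m : ℝ) * P| ≤ 3 * |(n : ℝ)| := by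
        rw [abs_le]
        constructor <;> nlinarith [le_abs_self (n : ℝ), neg_abs_le (n : ℝ)]
      have hm2 : ((m : ℝ) * P) ^ 2 ≤ 9 * (n : ℝ) ^ 2 := by
        rw [← sq_abs, ← sq_abs (n : ℝ)]
        nlinarith [abs_nonneg ((m : ℝ) * P)]
      have hP2 : P ^ 2 ≤ 4 * (n : ℝ) ^ 2 := by
        rw [← sq_abs (n : ℝ)]
        nlinarith
      have hn2 : 0 < (n : ℝ) ^ 2 := by positivity
      rw [div_le_div_iff₀ hn2 (by positivity)]
      have : T * (P * (1 + (m : ℝ) ^ 2)) ≤ 2 * P * (P * (1 + (m : ℝ) ^ 2)) :=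
        mul_le_mul_of_nonneg_right hT (by positivity)
      nlinarith

lemma one_div_le_dist_of_abs_le {s : ℕ} {a : Fin s → ℝ} {φ : ℝ → ℝ}
    (hφ : ∀ t : ℝ, 0 < t → 0 < φ t) (hmono : StrictMonoOn φ (Set.Ioi 0))
    (hdio : ∀ h : Fin s → ℤ, h ≠ 0 →
      1 / φ ((Finset.univ.sup fun i => (h i).natAbs : ℕ) : ℝ)
        ≤ |(∑ i, (h i : ℝ) * a i) - round (∑ i, (h i : ℝ) * a i)|)
    {h : Fin s → ℤ} (hh : h ≠ 0) {ρ : ℝ} (hρ : ∀ i, |(h i : ℝ)| ≤ ρ) :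
    1 / φ ρ ≤ |(∑ i, (h i : ℝ) * a i) - round (∑ i, (h i : ℝ) * a i)| := by
  obtain ⟨i, hi⟩ := Function.ne_iff.1 hh
  set k := Finset.univ.sup fun i => (h i).natAbs with hk
  have hk0 : 0 < k :=
    (Int.natAbs_pos.2 hi).trans_le (Finset.le_sup (f := fun i => (h i).natAbs) (Finset.mem_univ i))
  have hkR : (0 : ℝ) < k := by exact_mod_cast hk0
  have hkρ : (k : ℝ) ≤ ρ := by
    obtain ⟨j, -, hj⟩ := Finset.exists_mem_eq_sup Finset.univ ⟨i, Finset.mem_univ i⟩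
      fun i => (h i).natAbs
    rw [hk, hj, Nat.cast_natAbs, Int.cast_abs]
    exact hρ j
  refine le_trans ?_ (hdio h hh)
  exact one_div_le_one_div_of_le (hφ _ hkR)
    (hmono.monotoneOn hkR (hkR.trans_le hkρ : (0 : ℝ) < ρ) hkρ)

lemma abs_sub_le_cellLength {J : ℕ} {C : ℕ ⊕ ℤ} {n n' : ℤ} (hn : latticeCell J C n)
    (hn' : latticeCell J C n') : |(n : ℝ) - n'| ≤ cellLength J C := by
  rcases C with j | m <;> simp only [latticeCell, cellLength, Sum.elim_inl, Sum.elim_inr] at *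
  · have h1 : |(n : ℝ)| < 2 ^ j := by exact_mod_cast hn
    have h2 : |(n' : ℝ)| < 2 ^ j := by exact_mod_cast hn'
    rw [pow_succ]
    linarith [abs_sub (n : ℝ) n']
  · have hP : (0 : ℤ) < 2 ^ J := by positivity
    have h1 := Int.ediv_mul_le n hP.ne'
    have h2 := Int.lt_ediv_add_one_mul_self n hP
    have h3 := Int.ediv_mul_le n' hP.ne'
    have h4 := Int.lt_ediv_add_one_mul_self n' hP
    rw [hn] at h1 h2
    rw [hn'] at h3 h4
    have : |n - n'| ≤ 2 ^ J := by
      rw [abs_le]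
      constructor <;> linarith
    exact_mod_cast this

open Classical in
/-- The exponential sums with frequencies in a box of cells. -/
lemma sum_box_le {s : ℕ} (hs : 0 < s) {a : Fin s → ℝ} {φ : ℝ → ℝ}
    (hφ : ∀ t : ℝ, 0 < t → 0 < φ t) (hmono : StrictMonoOn φ (Set.Ioi 0))
    (hdiv : ∀ t₁ t₂ : ℝ, 0 < t₁ → t₁ ≤ t₂ → φ t₁ / t₁ ≤ φ t₂ / t₂)
    (hdio : ∀ h : Fin s → ℤ, h ≠ 0 →
      1 / φ ((Finset.univ.sup fun i => (h i).natAbs : ℕ) : ℝ)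
        ≤ |(∑ i, (h i : ℝ) * a i) - round (∑ i, (h i : ℝ) * a i)|)
    (hφ1 : 1 ≤ φ 1) (N₀ N : ℕ) {T : ℝ} (hN : φ T = N) (hlog : 1 ≤ Real.log N)
    {J : ℕ} (hJ : 2 ^ J ≤ T) (hJ' : T ≤ 2 * 2 ^ J) (H : Finset (Fin s → ℤ)) (hH : 0 ∉ H)
    (Q : Fin s → ℕ ⊕ ℤ) (hQ : ∀ i j, Q i = Sum.inl j → j < J) :
    ∑ h ∈ H with ∀ i, latticeCell J (Q i) (h i),
        ‖∑ n ∈ Finset.Ioc N₀ (N₀ + N), addExp (n * ∑ i, (h i : ℝ) * a i)‖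
      ≤ 24 * N * Real.log N / T * ∑ i, cellLength J (Q i) := by
  have hJpos : (1 : ℝ) ≤ 2 ^ J := one_le_pow₀ one_le_two
  have hT : 0 < T := by linarith
  have hNpos : (0 : ℝ) < N := hN ▸ hφ T hT
  have hne : ∀ h ∈ H, h ≠ 0 := fun h hh h0 => hH (h0 ▸ hh)
  have : Nonempty (Fin s) := ⟨⟨0, hs⟩⟩
  obtain ⟨i₀, hi₀⟩ := Finite.exists_max fun i => cellLength J (Q i)
  set ρ := cellLength J (Q i₀) with hρ
  have hlen : ∀ C : ℕ ⊕ ℤ, 1 ≤ cellLength J C := by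
    intro C
    rcases C with j | m <;> simp only [cellLength, Sum.elim_inl, Sum.elim_inr] <;>
      exact one_le_pow₀ one_le_two
  have hρ1 : 1 ≤ ρ := hlen _
  have hρJ : ρ ≤ 2 ^ J := by
    rw [hρ]
    rcases hC : Q i₀ with j | m <;> simp only [cellLength, Sum.elim_inl, Sum.elim_inr]
    · exact pow_le_pow_right₀ one_le_two (hQ i₀ j hC)
    · rfl
  have hφρ : φ ρ ≤ N := hN ▸ hmono.monotoneOn (Set.mem_Ioi.2 (by linarith)) hT (by linarith)
  have hφρ1 : 1 ≤ φ ρ :=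
    hφ1.trans (hmono.monotoneOn (Set.mem_Ioi.2 one_pos) (Set.mem_Ioi.2 (by linarith)) hρ1)
  have hsum : ρ ≤ ∑ i, cellLength J (Q i) :=
    Finset.single_le_sum (f := fun i => cellLength J (Q i))
      (fun i _ => (cellLength_pos J _).le) (Finset.mem_univ i₀)
  set X := H.filter fun h => ∀ i, latticeCell J (Q i) (h i) with hX
  have main : ∀ M : ℝ, φ ρ ≤ M → M ≤ N → M ≤ 2 * (N / T * ρ) →
      (∀ h ∈ X, ‖∑ n ∈ Finset.Ioc N₀ (N₀ + N), addExp (n * ∑ i, (h i : ℝ) * a i)‖ ≤ M) →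
      ∑ h ∈ X, ‖∑ n ∈ Finset.Ioc N₀ (N₀ + N), addExp (n * ∑ i, (h i : ℝ) * a i)‖
        ≤ 24 * N * Real.log N / T * ∑ i, cellLength J (Q i) := by
    intro M hM hMN hMρ hF
    have hM1 : 1 ≤ M := hφρ1.trans hM
    have hMlog : Real.log M ≤ Real.log N := Real.log_le_log (by linarith) hMN
    refine (sum_le_of_separated X (fun h => ∑ i, (h i : ℝ) * a i) _ hM1 ?_ hF
      fun h _ => norm_sum_addExp_mul_dist_round_le N₀ N _).trans ?_
    · intro h hh h' hh' hhh'
      refine (one_div_le_one_div_of_le (by linarith) hM).trans ?_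
      have := one_div_le_dist_of_abs_le hφ hmono hdio (sub_ne_zero.2 hhh') (ρ := ρ) ?_
      · simpa only [Pi.sub_apply, Int.cast_sub, sub_mul, Finset.sum_sub_distrib] using this
      · intro i
        rw [Pi.sub_apply, Int.cast_sub]
        exact (abs_sub_le_cellLength ((Finset.mem_filter.1 hh).2 i)
          ((Finset.mem_filter.1 hh').2 i)).trans (hi₀ i)
    · calc 4 * M * (2 + Real.log M) ≤ 4 * (2 * (N / T * ρ)) * (3 * Real.log N) := by
            gcongr
            · have := Real.log_nonneg hM1
              linarith
            · linarith
        _ = 24 * N * Real.log N / T * ρ := by ring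
        _ ≤ _ := by gcongr
  by_cases hall : ∀ i, ∃ j, Q i = Sum.inl j
  · refine main (φ ρ) le_rfl hφρ ?_ ?_
    · have := hdiv ρ T (by linarith) (by linarith)
      rw [hN, div_le_iff₀ (by linarith)] at this
      have h0 : 0 ≤ N / T * ρ := by positivity
      linarith
    · intro h hh
      obtain ⟨hhH, hcell⟩ := Finset.mem_filter.1 hh
      have h1 := one_div_le_dist_of_abs_le hφ hmono hdio (hne h hhH) (ρ := ρ) ?_
      · have h2 := norm_sum_addExp_mul_dist_round_le N₀ N (∑ i, (h i : ℝ) * a i)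
        have h3 := mul_le_mul_of_nonneg_left h1 (norm_nonneg
          (∑ n ∈ Finset.Ioc N₀ (N₀ + N), addExp (n * ∑ i, (h i : ℝ) * a i)))
        have h4 := h3.trans h2
        rwa [mul_one_div, div_le_one (by linarith)] at h4
      · intro i
        obtain ⟨j, hj⟩ := hall i
        refine le_trans ?_ (hi₀ i)
        have := hcell i
        rw [hj] at this ⊢
        simp only [latticeCell, cellLength, Sum.elim_inl] at this ⊢
        have h5 : |(h i : ℝ)| < 2 ^ j := by exact_mod_cast this
        have h6 : (2 : ℝ) ^ j ≤ 2 ^ (j + 1) := pow_le_pow_right₀ one_le_two (by omega)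
        linarith
  · push Not at hall
    obtain ⟨i, hi⟩ := hall
    have hρeq : ρ = 2 ^ J := by
      refine le_antisymm hρJ (le_trans ?_ (hi₀ i))
      rcases hC : Q i with j | m
      · exact absurd hC (hi j)
      · simp [cellLength]
    refine main N hφρ le_rfl ?_ fun h _ => norm_sum_addExp_le _ _ _
    rw [hρeq]
    calc (N : ℝ) = N / T * T := by field_simp
      _ ≤ N / T * (2 * 2 ^ J) := by gcongr
      _ = _ := by ring

lemma sum_prod_trig_eq {s : ℕ} (a : Fin s → ℝ) (I : Finset ℕ) (A : Finset ℤ)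
    (c : Fin s → ℤ → ℂ) :
    ∑ n ∈ I, ∏ i, ∑ k ∈ A, c i k * addExp (k * (n * a i))
      = ∑ h ∈ Fintype.piFinset fun _ : Fin s => A,
          (∏ i, c i (h i)) * ∑ n ∈ I, addExp (n * ∑ i, (h i : ℝ) * a i) := by
  simp_rw [Finset.prod_univ_sum, Finset.mul_sum]
  rw [Finset.sum_comm]
  refine Finset.sum_congr rfl fun h _ => Finset.sum_congr rfl fun n _ => ?_
  rw [Finset.prod_mul_distrib, addExp_sum]
  congr 1
  exact Finset.prod_congr rfl fun i _ => by rw [mul_left_comm]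

open Classical in
lemma norm_sum_prod_trig_sub_le {s : ℕ} (hs : 0 < s) {a : Fin s → ℝ} {φ : ℝ → ℝ}
    (hφ : ∀ t : ℝ, 0 < t → 0 < φ t) (hmono : StrictMonoOn φ (Set.Ioi 0))
    (hdiv : ∀ t₁ t₂ : ℝ, 0 < t₁ → t₁ ≤ t₂ → φ t₁ / t₁ ≤ φ t₂ / t₂)
    (hdio : ∀ h : Fin s → ℤ, h ≠ 0 →
      1 / φ ((Finset.univ.sup fun i => (h i).natAbs : ℕ) : ℝ)
        ≤ |(∑ i, (h i : ℝ) * a i) - round (∑ i, (h i : ℝ) * a i)|)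
    (hφ1 : 1 ≤ φ 1) (N₀ N : ℕ) {T : ℝ} (hN : φ T = N) (hlog : 1 ≤ Real.log N)
    {J : ℕ} (hJ1 : 1 ≤ J) (hJ : 2 ^ J ≤ T) (hJ' : T ≤ 2 * 2 ^ J)
    {A : Finset ℤ} (hA : 0 ∈ A) {c : Fin s → ℤ → ℂ} (hc0 : ∀ i, ‖c i 0‖ ≤ 2)
    (hc : ∀ i, ∀ k : ℤ, k ≠ 0 → ‖c i k‖ ≤ 1 / |(k : ℝ)| ∧ ‖c i k‖ ≤ T / (k : ℝ) ^ 2) :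
    ‖∑ n ∈ Finset.Ioc N₀ (N₀ + N), ∏ i, ∑ k ∈ A, c i k * addExp (k * (n * a i))
        - N * ∏ i, c i 0‖
      ≤ 24 * N * Real.log N / T * (s * ((∑ C ∈ latticeCells J A, cellWeight J C * cellLength J C)
        * (∑ C ∈ latticeCells J A, cellWeight J C) ^ (s - 1))) := by
  have h0 : (0 : Fin s → ℤ) ∈ Fintype.piFinset fun _ : Fin s => A :=
    Fintype.mem_piFinset.2 fun _ => hA
  rw [sum_prod_trig_eq, ← Finset.add_sum_erase _ _ h0]
  have hzero : (∏ i, c i ((0 : Fin s → ℤ) i)) * ∑ n ∈ Finset.Ioc N₀ (N₀ + N),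
      addExp (n * ∑ i, ((0 : Fin s → ℤ) i : ℝ) * a i) = N * ∏ i, c i 0 := by
    simp [addExp_zero, mul_comm]
  rw [hzero, add_sub_cancel_left]
  refine (norm_sum_le _ _).trans ?_
  simp_rw [norm_mul, norm_prod]
  refine sum_prod_mul_le_of_cells _ (latticeCells J A) (latticeCell J) (cellWeight J)
    (cellLength J) (cellWeight_nonneg J) (fun i k => ‖c i k‖) (fun _ _ => norm_nonneg _)
    (fun h => ‖∑ n ∈ Finset.Ioc N₀ (N₀ + N), addExp (n * ∑ i, (h i : ℝ) * a i)‖)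
    (fun _ => norm_nonneg _) ?_ ?_
  · intro i h hh
    refine le_sum_cellWeight hJ1 hJ' (Fintype.mem_piFinset.1 (Finset.mem_of_mem_erase hh) i) ?_
      (hc i (h i))
    intro hi
    rw [hi]
    exact hc0 i
  · intro Q hQ
    refine sum_box_le hs hφ hmono hdiv hdio hφ1 N₀ N hN hlog hJ hJ' _ (by simp) Q ?_
    intro i j hij
    have := hQ i
    rw [hij] at this
    simpa [latticeCells] using this

lemma prod_add_le {s : ℕ} (x : Fin s → ℝ) {δ : ℝ} (hδ : 0 ≤ δ) (hδ1 : δ ≤ 1)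
    (hx0 : ∀ i, 0 ≤ x i) (hx1 : ∀ i, x i ≤ 1) :
    ∏ i, (x i + δ) ≤ ∏ i, x i + (2 ^ s - 1) * δ := by
  induction s with
  | zero => simp
  | succ s ih =>
    rw [Fin.prod_univ_succ, Fin.prod_univ_succ]
    have h := ih (fun i => x i.succ) (fun i => hx0 _) fun i => hx1 _
    have hP : ∏ i : Fin s, x i.succ ≤ 1 :=
      Finset.prod_le_one (fun i _ => hx0 _) fun i _ => hx1 _
    have h2 : (1 : ℝ) ≤ 2 ^ s := one_le_pow₀ one_le_two
    have h3 : 0 ≤ ((2 : ℝ) ^ s - 1) * δ := mul_nonneg (by linarith) hδ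
    have h4 := hx0 0
    have h5 := hx1 0
    calc _ ≤ (x 0 + δ) * (∏ i : Fin s, x i.succ + (2 ^ s - 1) * δ) := by gcongr
      _ ≤ _ := by
        rw [pow_succ]
        nlinarith

/-- The constant governing the total weight of the lattice cells. -/
noncomputable def weightConst : ℝ := 4 + 32 * ∑' m : ℤ, 1 / (1 + (m : ℝ) ^ 2)

lemma four_le_weightConst : 4 ≤ weightConst := by
  have : 0 ≤ ∑' m : ℤ, 1 / (1 + (m : ℝ) ^ 2) := tsum_nonneg fun m => by positivity
  rw [weightConst]
  linarith

open Classical in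
/-- Upper bound for the number of `n` with `n a` in a product of arcs. -/
lemma sum_prod_arc_le {s : ℕ} (hs : 0 < s) {a : Fin s → ℝ} {φ : ℝ → ℝ}
    (hφ : ∀ t : ℝ, 0 < t → 0 < φ t) (hmono : StrictMonoOn φ (Set.Ioi 0))
    (hdiv : ∀ t₁ t₂ : ℝ, 0 < t₁ → t₁ ≤ t₂ → φ t₁ / t₁ ≤ φ t₂ / t₂)
    (hdio : ∀ h : Fin s → ℤ, h ≠ 0 →
      1 / φ ((Finset.univ.sup fun i => (h i).natAbs : ℕ) : ℝ)
        ≤ |(∑ i, (h i : ℝ) * a i) - round (∑ i, (h i : ℝ) * a i)|)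
    (hφ1 : 1 ≤ φ 1) (N₀ N : ℕ) {T : ℝ} (hT : Real.exp 1 ≤ T) (hN : φ T = N)
    (hlog : 1 ≤ Real.log N) (α β : Fin s → ℝ) (hαβ : ∀ i, α i ≤ β i ∧ β i ≤ α i + 1) :
    ∑ n ∈ Finset.Ioc N₀ (N₀ + N), ∏ i, (⌊n * a i - α i⌋ - ⌊n * a i - β i⌋ : ℝ)
      ≤ N * (∏ i, (β i - α i)
        + 49 * (2 * weightConst) ^ s * (Real.log N * Real.log T / T)) := by
  have he := Real.exp_one_gt_d9
  have hT2 : 2 < T := by linarith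
  have hT0 : 0 < T := by linarith
  have hlogT : 1 ≤ Real.log T := by
    rw [← Real.log_exp 1]
    exact Real.log_le_log (Real.exp_pos 1) hT
  have hNpos : (0 : ℝ) < N := hN ▸ hφ T hT0
  have hV := four_le_weightConst
  have hδ0 : 0 < 1 / T := by positivity
  have hδ1 : 1 / T < 1 := by rw [div_lt_one hT0]; linarith
  obtain ⟨J, hJ1, hJ, hJ', hJlog⟩ : ∃ J : ℕ, 1 ≤ J ∧ (2 : ℝ) ^ J ≤ T ∧ T ≤ 2 * 2 ^ J ∧
      (J : ℝ) ≤ 2 * Real.log T := by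
    have hfl : 2 ≤ ⌊T⌋₊ := Nat.le_floor (by exact_mod_cast hT2.le)
    have h1 : (2 : ℝ) ^ Nat.log 2 ⌊T⌋₊ ≤ T := by
      refine le_trans ?_ (Nat.floor_le hT0.le)
      exact_mod_cast Nat.pow_log_le_self 2 (by omega)
    refine ⟨Nat.log 2 ⌊T⌋₊, Nat.log_pos one_lt_two hfl, h1, ?_, ?_⟩
    · have h2 : ⌊T⌋₊ + 1 ≤ 2 ^ (Nat.log 2 ⌊T⌋₊ + 1) := Nat.lt_pow_succ_log_self one_lt_two _
      have h3 : (⌊T⌋₊ : ℝ) + 1 ≤ 2 ^ (Nat.log 2 ⌊T⌋₊ + 1) := by exact_mod_cast h2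
      rw [pow_succ] at h3
      linarith [Nat.lt_floor_add_one T]
    · have h2 := Real.log_le_log (by positivity) h1
      rw [Real.log_pow] at h2
      have h3 := Real.log_two_gt_d9
      have h4 : (0 : ℝ) ≤ (Nat.log 2 ⌊T⌋₊ : ℝ) := Nat.cast_nonneg _
      nlinarith
  choose c f hc0 hc hf hχ using fun i => exists_arc_majorant hδ0 hδ1 (α i) (β i)
  have hχ0 : ∀ i x, (0 : ℝ) ≤ (⌊x - α i⌋ - ⌊x - β i⌋ : ℝ) := by
    intro i x
    rw [sub_nonneg]
    exact_mod_cast Int.floor_le_floor (by linarith [(hαβ i).1])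
  have hR : 1 / T ≤ Real.log N * Real.log T / T := by
    gcongr
    nlinarith
  have htrunc : ∀ A : Finset ℤ, 0 ∈ A →
      ‖∑ n ∈ Finset.Ioc N₀ (N₀ + N), ∏ i, ∑ k ∈ A, c i k * addExp (k * (n * a i))
        - N * ∏ i, c i 0‖
      ≤ N * (48 * (2 * weightConst) ^ s * (Real.log N * Real.log T / T)) := by
    intro A hA
    refine (norm_sum_prod_trig_sub_le hs hφ hmono hdiv hdio hφ1 N₀ N hN hlog hJ1 hJ hJ' hA
      ?_ ?_).trans ?_
    · intro i
      rw [hc0, Complex.norm_real, Real.norm_eq_abs, abs_le]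
      constructor <;> linarith [hαβ i]
    · intro i k hk
      refine ⟨(hc i k hk).1, (hc i k hk).2.trans_eq ?_⟩
      have : (k : ℝ) ≠ 0 := by exact_mod_cast hk
      field_simp
    · have h1 : ∑ C ∈ latticeCells J A, cellWeight J C ≤ weightConst := sum_cellWeight_le J A
      have h2 : ∑ C ∈ latticeCells J A, cellWeight J C * cellLength J C
          ≤ 2 * weightConst * Real.log T := by
        refine (sum_cellWeight_mul_cellLength_le J A).trans ?_
        have : 32 * ∑' m : ℤ, 1 / (1 + (m : ℝ) ^ 2) = weightConst - 4 := by
          rw [weightConst]; ring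
        rw [this]
        nlinarith
      have h3 : (s : ℝ) ≤ 2 ^ s := by exact_mod_cast Nat.lt_two_pow_self.le
      have h4 : 0 ≤ ∑ C ∈ latticeCells J A, cellWeight J C :=
        Finset.sum_nonneg fun C _ => cellWeight_nonneg J C
      have h6 : 0 ≤ ∑ C ∈ latticeCells J A, cellWeight J C * cellLength J C :=
        Finset.sum_nonneg fun C _ => mul_nonneg (cellWeight_nonneg J C) (cellLength_pos J C).le
      have h5 : weightConst * weightConst ^ (s - 1) = weightConst ^ s := by
        rw [← pow_succ', Nat.sub_add_cancel hs]
      calc _ ≤ 24 * N * Real.log N / T *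
            (2 ^ s * (2 * weightConst * Real.log T * weightConst ^ (s - 1))) := by
            gcongr
        _ = 48 * (weightConst * weightConst ^ (s - 1)) * 2 ^ s * N
              * (Real.log N * Real.log T / T) := by ring
        _ = _ := by rw [h5, mul_pow]; ring
  have hlim : Filter.Tendsto (fun A : Finset ℤ =>
      ‖∑ n ∈ Finset.Ioc N₀ (N₀ + N), ∏ i, ∑ k ∈ A, c i k * addExp (k * (n * a i))
        - N * ∏ i, c i 0‖) Filter.atTop
      (nhds ‖∑ n ∈ Finset.Ioc N₀ (N₀ + N), ∏ i, (f i (n * a i) : ℂ) - N * ∏ i, c i 0‖) := by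
    refine (Filter.Tendsto.sub_const ?_ _).norm
    exact tendsto_finsetSum _ fun n _ => tendsto_finsetProd _ fun i _ => hf i (n * a i)
  have hmain := le_of_tendsto hlim
    ((Filter.eventually_ge_atTop ({0} : Finset ℤ)).mono fun A hA =>
      htrunc A (hA (Finset.mem_singleton_self 0)))
  have hreal : ∑ n ∈ Finset.Ioc N₀ (N₀ + N), ∏ i, f i (n * a i) - N * ∏ i, (β i - α i + 1 / T)
      ≤ N * (48 * (2 * weightConst) ^ s * (Real.log N * Real.log T / T)) := by
    refine le_trans (le_abs_self _) ?_
    rw [← Real.norm_eq_abs, ← Complex.norm_real]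
    refine le_trans (le_of_eq ?_) hmain
    congr 1
    push_cast
    congr 2
    refine Finset.prod_congr rfl fun i _ => ?_
    rw [hc0]
    push_cast
    rfl
  have hprod := prod_add_le (fun i => β i - α i) hδ0.le hδ1.le
    (fun i => by linarith [(hαβ i).1]) (fun i => by linarith [(hαβ i).2])
  have hle : ∑ n ∈ Finset.Ioc N₀ (N₀ + N), ∏ i, (⌊n * a i - α i⌋ - ⌊n * a i - β i⌋ : ℝ)
      ≤ ∑ n ∈ Finset.Ioc N₀ (N₀ + N), ∏ i, f i (n * a i) :=
    Finset.sum_le_sum fun n _ => Finset.prod_le_prod (fun i _ => hχ0 i _) fun i _ => hχ i _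
  have hpow : (2 ^ s - 1) * (1 / T)
      ≤ (2 * weightConst) ^ s * (Real.log N * Real.log T / T) := by
    have h1 : (2 : ℝ) ^ s ≤ (2 * weightConst) ^ s := by
      gcongr
      linarith
    gcongr
    linarith
  nlinarith [mul_le_mul_of_nonneg_left (hprod.trans (add_le_add_right hpow _)) hNpos.le]

lemma floor_sub_sub_floor_sub {α β : ℝ} (h0 : 0 ≤ α) (hαβ : α ≤ β) (h1 : β ≤ 1) (x : ℝ)
    [Decidable (Int.fract x ∈ Set.Ico α β)] :
    (⌊x - α⌋ - ⌊x - β⌋ : ℝ) = if Int.fract x ∈ Set.Ico α β then 1 else 0 := by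
  have hx0 := Int.fract_nonneg x
  have hx1 := Int.fract_lt_one x
  have key : ∀ γ : ℝ, 0 ≤ γ → γ ≤ 1 → ⌊x - γ⌋ = ⌊x⌋ + if γ ≤ Int.fract x then 0 else -1 := by
    intro γ hγ0 hγ1
    have := Int.self_sub_floor x
    rw [Int.floor_eq_iff]
    split_ifs with h <;> push_cast <;> constructor <;> linarith
  rw [key α h0 (hαβ.trans h1), key β (h0.trans hαβ) h1]
  simp only [Set.mem_Ico]
  split_ifs <;> push_cast <;> first | linarith | grind

lemma prod_ite_lt_ite_eq {s : ℕ} (p : Fin s → ℝ) (q : ℝ) (i : Fin s) :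
    ∏ j, (if j < i then p j else if j = i then q else 1) = q * ∏ j with j < i, p j := by
  calc _ = ∏ j, ((if j = i then q else 1) * if j < i then p j else 1) := by
        refine Finset.prod_congr rfl fun j _ => ?_
        split_ifs with h1 h2
        · exact absurd h2 h1.ne
        all_goals simp
    _ = _ := by
        rw [Finset.prod_mul_distrib, Finset.prod_filter]
        simp

lemma one_sub_prod_eq {s : ℕ} (p : Fin s → ℝ) :
    1 - ∏ i, p i = ∑ i, ∏ j, (if j < i then p j else if j = i then 1 - p i else 1) := by
  have h := Finset.prod_one_sub_ordered Finset.univ fun i => 1 - p i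
  simp only [sub_sub_cancel] at h
  rw [h, sub_sub_cancel]
  exact Finset.sum_congr rfl fun i _ => (prod_ite_lt_ite_eq _ _ i).symm

/-- Upper bounds for products of arcs imply lower bounds, by splitting the complement of a box
into products of arcs. -/
lemma abs_sum_prod_arc_sub_le {s : ℕ} (hs : 0 < s) (a : Fin s → ℝ) (I : Finset ℕ) {N D : ℝ}
    (hI : (I.card : ℝ) = N) (hN : 0 < N) (hD : 0 ≤ D)
    (hupper : ∀ α β : Fin s → ℝ, (∀ i, α i ≤ β i ∧ β i ≤ α i + 1) →
      ∑ n ∈ I, ∏ i, (⌊n * a i - α i⌋ - ⌊n * a i - β i⌋ : ℝ) ≤ N * (∏ i, (β i - α i) + D))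
    (α β : Fin s → ℝ) (hαβ : ∀ i, α i ≤ β i ∧ β i ≤ α i + 1) :
    |(∑ n ∈ I, ∏ i, (⌊n * a i - α i⌋ - ⌊n * a i - β i⌋ : ℝ)) / N - ∏ i, (β i - α i)|
      ≤ s * D := by
  have hs1 : (1 : ℝ) ≤ s := by exact_mod_cast hs
  have hcompl : ∀ i : Fin s,
      ∑ n ∈ I, ∏ j, (if j < i then (⌊n * a j - α j⌋ - ⌊n * a j - β j⌋ : ℝ) else
        if j = i then 1 - (⌊n * a i - α i⌋ - ⌊n * a i - β i⌋ : ℝ) else 1)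
      ≤ N * (∏ j, (if j < i then β j - α j else if j = i then 1 - (β i - α i) else 1) + D) := by
    intro i
    refine le_of_eq_of_le ?_ ((hupper (fun j => if j < i then α j else if j = i then β i else 0)
      (fun j => if j < i then β j else if j = i then α i + 1 else 1) ?_).trans_eq ?_)
    · refine Finset.sum_congr rfl fun n _ => Finset.prod_congr rfl fun j _ => ?_
      split_ifs with h1 h2
      · rfl
      · subst h2
        rw [← sub_sub, Int.floor_sub_one]
        push_cast
        ring
      · rw [Int.floor_sub_one]
        simp
    · intro j
      have := hαβ j
      split_ifs with h1 h2
      · exact this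
      · subst h2
        constructor <;> linarith
      · norm_num
    · congr 2
      refine Finset.prod_congr rfl fun j _ => ?_
      split_ifs <;> ring
  have hsum : N - ∑ n ∈ I, ∏ i, (⌊n * a i - α i⌋ - ⌊n * a i - β i⌋ : ℝ)
      ≤ N * (1 - ∏ i, (β i - α i)) + N * (s * D) := by
    calc _ = ∑ n ∈ I, (1 - ∏ i, (⌊n * a i - α i⌋ - ⌊n * a i - β i⌋ : ℝ)) := by
          rw [Finset.sum_sub_distrib, ← hI]
          simp
      _ = ∑ i : Fin s, ∑ n ∈ I,
            ∏ j, (if j < i then (⌊n * a j - α j⌋ - ⌊n * a j - β j⌋ : ℝ) else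
              if j = i then 1 - (⌊n * a i - α i⌋ - ⌊n * a i - β i⌋ : ℝ) else 1) := by
          rw [Finset.sum_comm]
          exact Finset.sum_congr rfl fun n _ => one_sub_prod_eq _
      _ ≤ ∑ i : Fin s, N *
            (∏ j, (if j < i then β j - α j else if j = i then 1 - (β i - α i) else 1) + D) :=
          Finset.sum_le_sum fun i _ => hcompl i
      _ = _ := by
          rw [← Finset.mul_sum, Finset.sum_add_distrib, ← one_sub_prod_eq]
          simp [mul_add]
  have hup := hupper α β hαβ
  have hDs : D ≤ s * D := le_mul_of_one_le_left hD hs1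
  rw [abs_le, le_sub_iff_add_le, sub_le_iff_le_add, le_div_iff₀ hN, div_le_iff₀ hN]
  constructor <;> nlinarith


open Finset Classical in

/-- Quantitative Kronecker theorem (Drmota–Tichy, Theorem 1.80, with explicit dependence
on the dimension): a Diophantine lower bound `‖h·a‖ ≥ 1/φ(|h|_∞)` yields an upper bound
for the discrepancy modulo 1 of the sequence `(n a)_{n=N₀+1}^{N₀+N}`.  The discrepancy
bound is expressed by the defining property: for every box `∏ [aᵢ, bᵢ) ⊆ [0,1)^s`, the
deviation of the counting quotient from the volume is at most the stated quantity. -/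
theorem quantitative_kronecker :
    ∃ c : ℝ, 0 < c ∧
      ∀ (s : ℕ), 2 ≤ s →
      ∀ (a : Fin s → ℝ),
        -- `1, a₁, …, a_s` linearly independent over `ℤ`
        (∀ (h₀ : ℤ) (h : Fin s → ℤ), (h₀ : ℝ) + ∑ i, (h i : ℝ) * a i = 0 →
          h₀ = 0 ∧ ∀ i, h i = 0) →
      ∀ (φ ψ : ℝ → ℝ),
        -- `φ : ℝ⁺ → ℝ⁺` is a strictly increasing bijection, with inverse `ψ`
        (∀ t : ℝ, 0 < t → 0 < φ t) →
        StrictMonoOn φ (Set.Ioi 0) →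
        (∀ y : ℝ, 0 < y → ∃ t : ℝ, 0 < t ∧ φ t = y) →
        (∀ t : ℝ, 0 < t → ψ (φ t) = t) →
        -- `φ(t)/t` is monotonically increasing
        (∀ t₁ t₂ : ℝ, 0 < t₁ → t₁ ≤ t₂ → φ t₁ / t₁ ≤ φ t₂ / t₂) →
        -- Diophantine hypothesis `‖h · a‖ ≥ 1/φ(|h|_∞)`
        (∀ h : Fin s → ℤ, h ≠ 0 →
          1 / φ ((Finset.univ.sup fun i => (h i).natAbs : ℕ) : ℝ)
            ≤ |(∑ i, (h i : ℝ) * a i) - round (∑ i, (h i : ℝ) * a i)|) →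
      ∀ (N₀ N : ℕ), 0 < N₀ → 0 < N → Real.exp 1 ≤ ψ N →
        -- discrepancy bound, for every box `∏ [αᵢ, βᵢ) ⊆ [0,1)^s`
        ∀ (α β : Fin s → ℝ), (∀ i, 0 ≤ α i ∧ α i ≤ β i ∧ β i ≤ 1) →
          |(((Finset.Ioc N₀ (N₀ + N)).filter
                (fun n : ℕ => ∀ i, Int.fract ((n : ℝ) * a i) ∈ Set.Ico (α i) (β i))).card : ℝ) / N
              - ∏ i, (β i - α i)|
            ≤ c ^ s * (s.factorial : ℝ) * (Real.log N * Real.log (ψ N)) / ψ N := by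
  have hV := four_le_weightConst
  refine ⟨196 * weightConst, by linarith, ?_⟩
  intro s hs a _ φ ψ hφ hmono hsurj hψ hdiv hdio N₀ N _ hN he α β hαβ
  have hs0 : 0 < s := by omega
  have hNpos : (0 : ℝ) < N := by exact_mod_cast hN
  have hψN : φ (ψ N) = N := by
    obtain ⟨t, ht, htN⟩ := hsurj N hNpos
    rw [← htN, hψ t ht]
  set T := ψ N
  have he' := Real.exp_one_gt_d9
  have hT0 : 0 < T := by linarith
  have hφ1 : 2 ≤ φ 1 := by
    have hne : (Pi.single ⟨0, hs0⟩ 1 : Fin s → ℤ) ≠ 0 := by simp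
    have h1 := one_div_le_dist_of_abs_le hφ hmono hdio hne (ρ := 1) fun i => by
      by_cases hi : i = ⟨0, hs0⟩
      · subst hi; simp
      · simp [hi]
    have h2 := h1.trans (abs_sub_round _)
    exact (one_div_le_one_div (hφ 1 one_pos) two_pos).1 h2
  have hNe : Real.exp 1 ≤ N := by
    have h := hdiv 1 T one_pos (by linarith)
    rw [div_one, hψN, le_div_iff₀ hT0] at h
    nlinarith
  have hlogN : 1 ≤ Real.log N := by
    rw [← Real.log_exp 1]
    exact Real.log_le_log (Real.exp_pos 1) hNe
  have hlogT : 1 ≤ Real.log T := by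
    rw [← Real.log_exp 1]
    exact Real.log_le_log (Real.exp_pos 1) he
  have hR : 0 ≤ Real.log N * Real.log T / T := by positivity
  have hcount : (((Finset.Ioc N₀ (N₀ + N)).filter
      (fun n : ℕ => ∀ i, Int.fract ((n : ℝ) * a i) ∈ Set.Ico (α i) (β i))).card : ℝ)
      = ∑ n ∈ Finset.Ioc N₀ (N₀ + N), ∏ i, (⌊n * a i - α i⌋ - ⌊n * a i - β i⌋ : ℝ) := by
    rw [Finset.card_filter, Nat.cast_sum]
    refine Finset.sum_congr rfl fun n _ => ?_
    rw [Finset.prod_congr rfl fun i _ =>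
      floor_sub_sub_floor_sub (hαβ i).1 (hαβ i).2.1 (hαβ i).2.2 (n * a i), Finset.prod_ite_zero]
    simp
  have hmain := abs_sum_prod_arc_sub_le hs0 a (Finset.Ioc N₀ (N₀ + N)) (N := N)
    (D := 49 * (2 * weightConst) ^ s * (Real.log N * Real.log T / T)) (by simp) hNpos
    (by positivity) (fun α β h => sum_prod_arc_le hs0 hφ hmono hdiv hdio (by linarith) N₀ N he
      hψN hlogN α β h) α β fun i => ⟨(hαβ i).2.1, by linarith [hαβ i]⟩
  rw [hcount]
  refine hmain.trans ?_
  have h2s : (s : ℝ) ≤ 2 ^ s := by exact_mod_cast Nat.lt_two_pow_self.le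
  have h49 : (49 : ℝ) ≤ 49 ^ s := le_self_pow₀ (by norm_num) hs0.ne'
  have hfact : (1 : ℝ) ≤ s.factorial := by exact_mod_cast Nat.factorial_pos s
  calc (s : ℝ) * (49 * (2 * weightConst) ^ s * (Real.log N * Real.log T / T))
      ≤ 2 ^ s * (49 ^ s * (2 * weightConst) ^ s * (Real.log N * Real.log T / T)) := by gcongr
    _ = (196 * weightConst) ^ s * 1 * (Real.log N * Real.log T / T) := by
        rw [show (196 : ℝ) * weightConst = 2 * (49 * (2 * weightConst)) by ring]
        simp only [mul_pow]
        ring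
    _ ≤ (196 * weightConst) ^ s * s.factorial * (Real.log N * Real.log T / T) := by gcongr
    _ = _ := by ring
end

section
/- (Besicovitch.) If q_1, …, q_s are pairwise distinct squarefree integers, each greater than 1, then the real numbers 1, √q_1, …, √q_s are linearly independent over ℚ (equivalently, over ℤ): there is no nonzero tuple (h_0, h_1, …, h_s) ∈ ℤ^{s+1} with h_0 + h_1 √q_1 + ⋯ + h_s √q_s = 0. -/
theorem Nat.eq_of_squarefree_of_isSquare_mul {a b : ℕ} (ha : Squarefree a) (hb : Squarefree b)
    (hab : IsSquare (a * b)) : a = b := by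
  obtain ⟨c, hc⟩ := hab
  have hac : a ∣ c := by
    rw [← ha.dvd_pow_iff_dvd two_ne_zero, sq, ← hc]
    exact dvd_mul_right a b
  obtain ⟨k, rfl⟩ := hac
  have hbk : b = a * (k * k) :=
    Nat.eq_of_mul_eq_mul_left (Nat.pos_of_ne_zero ha.ne_zero) (by rw [hc]; ring)
  have hk : k = 1 := Nat.isUnit_iff.mp (hb k ⟨a, by rw [hbk]; ring⟩)
  simp [hbk, hk]

open Polynomial in
theorem Algebra.trace_eq_zero_of_sq_eq_algebraMap {K L : Type*} [Field K] [Field L] [Algebra K L]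
    [FiniteDimensional K L] {x : L} {r : K} (hr : ¬ IsSquare r) (hx : x ^ 2 = algebraMap K L r) :
    Algebra.trace K L x = 0 := by
  have hirr : Irreducible (X ^ 2 - C r : K[X]) := by
    refine X_pow_sub_C_irreducible_of_prime Nat.prime_two fun b hb => hr ⟨b, ?_⟩
    rw [← hb, sq]
  have hmin : X ^ 2 - C r = minpoly K x :=
    minpoly.eq_of_irreducible_of_monic hirr (by simp [hx]) (monic_X_pow_sub_C r two_ne_zero)
  rw [trace_eq_finrank_mul_minpoly_nextCoeff, ← hmin,
    nextCoeff_of_natDegree_pos (by rw [natDegree_X_pow_sub_C]; norm_num), natDegree_X_pow_sub_C]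
  simp

theorem Real.linearIndependent_sqrt_of_squarefree {ι : Type*} [Finite ι] {q : ι → ℕ}
    (hq : ∀ i, Squarefree (q i)) (hinj : Function.Injective q) :
    LinearIndependent ℚ fun i => Real.sqrt (q i) := by
  have := Fintype.ofFinite ι
  rw [Fintype.linearIndependent_iff]
  intro g hg j
  let L := IntermediateField.adjoin ℚ (Set.range fun i => Real.sqrt (q i))
  have : FiniteDimensional ℚ L := by
    refine IntermediateField.finiteDimensional_adjoin ?_
    rintro _ ⟨i, rfl⟩
    refine IsIntegral.of_pow two_pos ?_
    rw [Real.sq_sqrt (Nat.cast_nonneg _), ← map_natCast (algebraMap ℚ ℝ)]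
    exact isIntegral_algebraMap
  let x : ι → L := fun i => ⟨Real.sqrt (q i), IntermediateField.subset_adjoin ℚ _ ⟨i, rfl⟩⟩
  have hx (i : ι) : x i ^ 2 = (q i : L) := Subtype.ext (by simp [x])
  have hsum : ∑ i, g i • (x i * x j) = 0 := by
    have h : ∑ i, g i • x i = 0 := Subtype.ext (by simpa [x] using hg)
    simpa [Finset.sum_mul] using congrArg (· * x j) h
  have htr := congrArg (Algebra.trace ℚ L) hsum
  rw [map_sum, Finset.sum_eq_single j, map_smul, ← sq, hx, map_zero] at htr
  · rw [← map_natCast (algebraMap ℚ L), Algebra.trace_algebraMap] at htr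
    simpa [(hq j).ne_zero, Module.finrank_pos.ne'] using htr
  · intro i _ hij
    rw [map_smul, Algebra.trace_eq_zero_of_sq_eq_algebraMap (r := ((q i * q j : ℕ) : ℚ)),
      smul_zero]
    · rw [Rat.isSquare_natCast_iff]
      exact fun h => hij (hinj (Nat.eq_of_squarefree_of_isSquare_mul (hq i) (hq j) h))
    · rw [mul_pow, hx, hx]
      simp
  · simp

/-- Besicovitch's theorem: square roots of distinct squarefree integers `> 1` are,
together with `1`, linearly independent over `ℤ`. -/
theorem besicovitch_sqrt_linear_independence (s : ℕ) (q : Fin s → ℕ)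
    (hq_sf : ∀ i, Squarefree (q i)) (hq_gt : ∀ i, 1 < q i)
    (hq_inj : Function.Injective q)
    (h₀ : ℤ) (h : Fin s → ℤ)
    (hrel : (h₀ : ℝ) + ∑ i, (h i : ℝ) * Real.sqrt (q i) = 0) :
    h₀ = 0 ∧ ∀ i, h i = 0 := by
  have hsf (i : Option (Fin s)) : Squarefree (i.elim 1 q) := by
    cases i with
    | none => exact squarefree_one
    | some i => exact hq_sf i
  have hinj : Function.Injective fun i : Option (Fin s) => i.elim 1 q := by
    rintro (_ | i) (_ | j) hij
    · rfl
    · exact absurd hij (hq_gt j).ne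
    · exact absurd hij (hq_gt i).ne'
    · exact congrArg some (hq_inj hij)
  have hlin := Fintype.linearIndependent_iff.mp (Real.linearIndependent_sqrt_of_squarefree hsf hinj)
    (fun i => (i.elim h₀ h : ℤ)) (by simpa [Fintype.sum_option, Rat.smul_def] using hrel)
  exact ⟨by simpa using hlin none, fun i => by simpa using hlin (some i)⟩
end

section
/- Let P ≥ 1 and let p_1 < p_2 < ⋯ < p_P be distinct prime numbers. Then the field extension ℚ(√p_1, …, √p_P) of ℚ has degree exactly 2^P. -/
open Polynomial IntermediateField in
/-- If `α ^ 2` lies in the base field, every element of `F⟮α⟯` has the form `a + b * α`. -/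
theorem exists_add_mul_of_mem_adjoin_simple {F E : Type*} [Field F] [Field E] [Algebra F E]
    {α : E} {c : F} (hα : α ^ 2 = algebraMap F E c) {x : E} (hx : x ∈ F⟮α⟯) :
    ∃ a b : F, x = algebraMap F E a + algebraMap F E b * α := by
  have hint : IsIntegral F α :=
    ⟨X ^ 2 - C c, monic_X_pow_sub_C c two_ne_zero, by simp [hα]⟩
  rw [← IntermediateField.mem_toSubalgebra,
    adjoin_simple_toSubalgebra_of_isAlgebraic hint.isAlgebraic] at hx
  induction hx using Algebra.adjoin_induction with
  | mem y hy =>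
    obtain rfl : y = α := hy
    exact ⟨0, 1, by simp⟩
  | algebraMap r => exact ⟨r, 0, by simp⟩
  | add y z _ _ hy hz =>
    obtain ⟨a, b, rfl⟩ := hy
    obtain ⟨a', b', rfl⟩ := hz
    exact ⟨a + a', b + b', by simp only [map_add]; ring⟩
  | mul y z _ _ hy hz =>
    obtain ⟨a, b, rfl⟩ := hy
    obtain ⟨a', b', rfl⟩ := hz
    refine ⟨a * a' + b * b' * c, a * b' + b * a', ?_⟩
    simp only [map_add, map_mul, ← hα]
    ring

open Polynomial IntermediateField in
/-- Adjoining a square root which is not in the base field gives an extension of degree two. -/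
theorem finrank_adjoin_simple_eq_two {F E : Type*} [Field F] [Field E] [Algebra F E]
    {α : E} {c : F} (hα : α ^ 2 = algebraMap F E c) (hmem : ∀ a : F, algebraMap F E a ≠ α) :
    Module.finrank F F⟮α⟯ = 2 := by
  have hirr : Irreducible (X ^ 2 - C c : F[X]) := by
    refine X_pow_sub_C_irreducible_of_prime Nat.prime_two fun b hb => ?_
    rw [← hb, map_pow, sq_eq_sq_iff_eq_or_eq_neg] at hα
    rcases hα with h | h
    · exact hmem b h.symm
    · exact hmem (-b) (by rw [map_neg, h])
  have hmonic : (X ^ 2 - C c : F[X]).Monic := monic_X_pow_sub_C c two_ne_zero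
  rw [adjoin.finrank ⟨_, hmonic, by simp [hα]⟩,
    ← minpoly.eq_of_irreducible_of_monic hirr (by simp [hα]) hmonic, natDegree_X_pow_sub_C]

open IntermediateField in
theorem adjoin_sqrt_insert (q : ℕ) (s : Finset ℕ) :
    adjoin ℚ ((fun n : ℕ => √(n : ℝ)) '' (insert q s : Finset ℕ)) =
      ((adjoin ℚ ((fun n : ℕ => √(n : ℝ)) '' s))⟮√(q : ℝ)⟯).restrictScalars ℚ := by
  rw [Finset.coe_insert, Set.image_insert_eq, ← Set.union_singleton]
  exact (adjoin_adjoin_left ℚ _ _).symm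

open IntermediateField in
/-- The square root of a squarefree number `d ≠ 1` is not in the field generated by the
square roots of primes not dividing `d`. -/
theorem sqrt_notMem_adjoin_sqrt_primes (s : Finset ℕ) (hs : ∀ q ∈ s, q.Prime) (d : ℕ)
    (hd : Squarefree d) (hd1 : d ≠ 1) (hdvd : ∀ q ∈ s, ¬ q ∣ d) :
    √(d : ℝ) ∉ adjoin ℚ ((fun n : ℕ => √(n : ℝ)) '' s) := by
  induction s using Finset.induction_on generalizing d with
  | empty =>
    intro h
    rw [Finset.coe_empty, Set.image_empty, adjoin_empty, mem_bot] at h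
    refine irrational_sqrt_natCast_iff.mpr ?_ h
    rintro ⟨r, rfl⟩
    have hr := Nat.isUnit_iff.mp (hd r dvd_rfl)
    simp [hr] at hd1
  | insert q s hqs ih =>
    intro h
    have hq : q.Prime := hs q (by simp)
    have hs' : ∀ r ∈ s, r.Prime := fun r hr => hs r (by simp [hr])
    have hds : ∀ r ∈ s, ¬ r ∣ d := fun r hr => hdvd r (by simp [hr])
    have hqd : ¬ q ∣ d := hdvd q (by simp)
    have hsq : ∀ r ∈ s, ¬ r ∣ q := fun r hr hrq =>
      hqs ((Nat.prime_dvd_prime_iff_eq (hs' r hr) hq).mp hrq ▸ hr)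
    have hqK := ih hs' q hq.prime.squarefree hq.ne_one hsq
    have hdK := ih hs' d hd hd1 hds
    have hdqK := ih hs' (d * q)
      ((Nat.squarefree_mul ((Nat.Prime.coprime_iff_not_dvd hq).mpr hqd).symm).mpr
        ⟨hd, hq.prime.squarefree⟩)
      (fun h1 => hd1 (Nat.eq_one_of_mul_eq_one_right h1))
      (fun r hr hrdq => ((hs' r hr).dvd_mul.mp hrdq).elim (hds r hr) (hsq r hr))
    rw [adjoin_sqrt_insert, mem_restrictScalars] at h
    set K := adjoin ℚ ((fun n : ℕ => √(n : ℝ)) '' s)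
    obtain ⟨⟨a, ha⟩, ⟨b, hb⟩, hab⟩ := exists_add_mul_of_mem_adjoin_simple (c := (q : K))
      (by rw [Real.sq_sqrt q.cast_nonneg, map_natCast]) h
    change √(d : ℝ) = a + b * √(q : ℝ) at hab
    have hqq : √(q : ℝ) ^ 2 = q := Real.sq_sqrt q.cast_nonneg
    have hdd : √(d : ℝ) ^ 2 = d := Real.sq_sqrt d.cast_nonneg
    by_cases hb0 : b = 0
    · exact hdK (by simpa [hab, hb0] using ha)
    by_cases ha0 : a = 0
    · refine hdqK ?_
      have : √((d * q : ℕ) : ℝ) = b * q := by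
        rw [Nat.cast_mul, Real.sqrt_mul d.cast_nonneg, hab, ha0, zero_add, mul_assoc,
          ← sq, hqq]
      rw [this]
      exact mul_mem hb (_root_.natCast_mem K q)
    · refine hqK ?_
      have : √(q : ℝ) = (d - a ^ 2 - b ^ 2 * q) / (2 * a * b) := by
        rw [eq_div_iff (by positivity), ← hdd, hab]
        linear_combination -b ^ 2 * hqq
      rw [this]
      exact div_mem (sub_mem (sub_mem (_root_.natCast_mem K d) (pow_mem ha 2))
        (mul_mem (pow_mem hb 2) (_root_.natCast_mem K q)))
        (mul_mem (mul_mem (ofNat_mem K 2) ha) hb)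

open IntermediateField in
theorem finrank_adjoin_sqrt_finset_primes (s : Finset ℕ) (hs : ∀ q ∈ s, q.Prime) :
    Module.finrank ℚ (adjoin ℚ ((fun n : ℕ => √(n : ℝ)) '' s)) = 2 ^ s.card := by
  induction s using Finset.induction_on with
  | empty => simp
  | insert q s hqs ih =>
    have hq : q.Prime := hs q (by simp)
    have hs' : ∀ r ∈ s, r.Prime := fun r hr => hs r (by simp [hr])
    have hqK := sqrt_notMem_adjoin_sqrt_primes s hs' q hq.prime.squarefree hq.ne_one
      fun r hr hrq => hqs ((Nat.prime_dvd_prime_iff_eq (hs' r hr) hq).mp hrq ▸ hr)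
    rw [adjoin_sqrt_insert, Finset.card_insert_of_notMem hqs, pow_succ, ← ih hs']
    set K := adjoin ℚ ((fun n : ℕ => √(n : ℝ)) '' s)
    have h2 : Module.finrank K K⟮√(q : ℝ)⟯ = 2 :=
      finrank_adjoin_simple_eq_two (c := (q : K))
        (by rw [Real.sq_sqrt q.cast_nonneg, map_natCast]) fun a ha => hqK (ha ▸ a.2)
    exact (h2 ▸ Module.finrank_mul_finrank ℚ K K⟮√(q : ℝ)⟯).symm

/-- The field `ℚ(√p₁, …, √p_P)` generated by the square roots of `P` distinct primes
has degree exactly `2 ^ P` over `ℚ`. -/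
theorem degree_adjoin_sqrt_primes (P : ℕ) (hP : 1 ≤ P) (p : Fin P → ℕ)
    (hp : ∀ i, Nat.Prime (p i)) (hmono : StrictMono p) :
    Module.finrank ℚ
      (IntermediateField.adjoin ℚ (Set.range fun i : Fin P => Real.sqrt (p i))) = 2 ^ P := by
  have h := finrank_adjoin_sqrt_finset_primes (Finset.univ.image p) (by simpa using hp)
  rwa [Finset.card_image_of_injective _ hmono.injective, Finset.card_fin, Finset.coe_image,
    Finset.coe_univ, Set.image_univ, ← Set.range_comp] at h
end

section
/- There is an absolute constant c > 0 with the following property. Let T ≥ 2 be real, let q_1 < ⋯ < q_s be all squarefree integers q with 1 < q ≤ T², let P = π(T²) be the number of primes ≤ T², and set a = (√q_1, …, √q_s). Then for every positive integer N with N^{2^{−P}}/(3sT) ≥ e, the discrepancy modulo 1 of the sequence (n a)_{n = N+1}^{2N} satisfies D_{N,N}(n a) ≤ c^s · s! · N^{−2^{−P}} · (log N)². -/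
/-- If every nonzero vector of a subgroup `L` has squared norm at least `m`, then every character
of `L` is given by the inner product with a short vector. -/
theorem exists_short_vector_of_character {E : Type*} [NormedAddCommGroup E]
    [InnerProductSpace ℝ E] [FiniteDimensional ℝ E] (d : ℕ) :
    ∀ (V : Submodule ℝ E), Module.finrank ℝ V ≤ d → ∀ (L : AddSubgroup E), (∀ l ∈ L, l ∈ V) →
      ∀ m : ℝ, 0 < m → (∀ l ∈ L, l ≠ 0 → m ≤ ‖l‖ ^ 2) → ∀ χ : L →+ UnitAddCircle,
        ∃ y ∈ V, ‖y‖ ^ 2 ≤ ((3 / 2) ^ d - 1) / m ∧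
          ∀ l : L, χ l = ((inner ℝ y (l : E) : ℝ) : UnitAddCircle) := by
  induction d with
  | zero =>
    intro V hV L hL m hm hmin χ
    refine ⟨0, V.zero_mem, by simp, fun l => ?_⟩
    have hV0 : V = ⊥ := Submodule.finrank_eq_zero.mp (Nat.le_zero.mp hV)
    have hl0 : l = 0 := by
      have := hL l l.2
      rw [hV0, Submodule.mem_bot] at this
      exact Subtype.ext this
    simp [hl0]
  | succ d ih =>
    intro V hV L hL m hm hmin χ
    by_cases hL0 : ∀ l ∈ L, l = 0
    · refine ⟨0, V.zero_mem, ?_, fun l => ?_⟩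
      · have : (1 : ℝ) ≤ (3 / 2) ^ (d + 1) := one_le_pow₀ (by norm_num)
        simpa using div_nonneg (by linarith) hm.le
      · have hl0 : l = 0 := Subtype.ext (hL0 l l.2)
        simp [hl0]
    push Not at hL0
    obtain ⟨l₀, hl₀, hl₀0⟩ := hL0
    obtain ⟨w, hwL, hw0, hw⟩ : ∃ w ∈ L, w ≠ 0 ∧
        ∀ v ∈ L, v ≠ 0 → ‖w‖ ^ 2 ≤ 4 / 3 * ‖v‖ ^ 2 := by
      let S : Set ℝ := {r | ∃ v ∈ L, v ≠ 0 ∧ ‖v‖ ^ 2 = r}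
      have hSne : S.Nonempty := ⟨_, l₀, hl₀, hl₀0, rfl⟩
      have hSbdd : BddBelow S := ⟨m, by rintro r ⟨v, hv, hv0, rfl⟩; exact hmin v hv hv0⟩
      have hinf : m ≤ sInf S := le_csInf hSne (by rintro r ⟨v, hv, hv0, rfl⟩; exact hmin v hv hv0)
      obtain ⟨r, ⟨w, hwL, hw0, rfl⟩, hr⟩ :=
        exists_lt_of_csInf_lt hSne (show sInf S < 4 / 3 * sInf S by linarith)
      refine ⟨w, hwL, hw0, fun v hv hv0 => ?_⟩
      have : sInf S ≤ ‖v‖ ^ 2 := csInf_le hSbdd ⟨v, hv, hv0, rfl⟩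
      linarith
    have hwpos : 0 < ‖w‖ ^ 2 := by positivity
    have hww : inner ℝ w w = ‖w‖ ^ 2 := real_inner_self_eq_norm_sq w
    let μ : E →ₗ[ℝ] ℝ := (‖w‖ ^ 2)⁻¹ • (innerₛₗ ℝ w)
    have hμ : ∀ x, μ x = (‖w‖ ^ 2)⁻¹ * inner ℝ w x := fun x => rfl
    have hμw : μ w = 1 := by rw [hμ, hww]; field_simp
    let pr : E →ₗ[ℝ] E := LinearMap.id - μ.smulRight w
    have hpr : ∀ x, pr x = x - μ x • w := fun x => rfl
    have hprw : pr w = 0 := by rw [hpr, hμw]; simp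
    have horth : ∀ x, inner ℝ w (pr x) = 0 := by
      intro x
      rw [hpr, inner_sub_right, inner_smul_right, hww, hμ]
      field_simp
      ring
    have hnorm : ∀ (x : E) (t : ℝ), ‖pr x + t • w‖ ^ 2 = ‖pr x‖ ^ 2 + t ^ 2 * ‖w‖ ^ 2 := by
      intro x t
      rw [norm_add_sq_real, inner_smul_right, real_inner_comm, horth, norm_smul, mul_pow,
        Real.norm_eq_abs, sq_abs]
      ring
    have hdecomp : ∀ x, x - (round (μ x)) • w = pr x + (μ x - round (μ x)) • w := by
      intro x
      rw [hpr, sub_smul, ← Int.cast_smul_eq_zsmul ℝ]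
      abel
    have hsmall : ∀ x, ‖x - (round (μ x)) • w‖ ^ 2 ≤ ‖pr x‖ ^ 2 + ‖w‖ ^ 2 / 4 := by
      intro x
      rw [hdecomp, hnorm]
      have h1 : (μ x - round (μ x)) ^ 2 ≤ (1 / 2) ^ 2 := by
        rw [← sq_abs]
        exact pow_le_pow_left₀ (abs_nonneg _) (abs_sub_round _) 2
      nlinarith
    have hmem : ∀ x ∈ L, x - (round (μ x)) • w ∈ L := fun x hx =>
      L.sub_mem hx (L.zsmul_mem hwL _)
    have hker : ∀ x ∈ L, pr x = 0 → x = (round (μ x)) • w := by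
      intro x hx h0
      by_contra hne
      have h1 := hw _ (hmem x hx) (sub_ne_zero.mpr hne)
      have h2 := hsmall x
      rw [h0] at h2
      simp only [norm_zero] at h2
      nlinarith
    let V' : Submodule ℝ E := V ⊓ (innerₛₗ ℝ w).ker
    have hV' : ∀ x, x ∈ V' ↔ x ∈ V ∧ inner ℝ w x = 0 := fun x => by
      simp [V']
    have hVlt : V' < V := by
      refine lt_of_le_of_ne inf_le_left fun h => ?_
      have : w ∈ V' := by rw [h]; exact hL w hwL
      rw [hV', hww] at this
      exact hwpos.ne' this.2
    have hrank : Module.finrank ℝ V' ≤ d := by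
      have := Submodule.finrank_lt_finrank_of_lt hVlt
      omega
    obtain ⟨t₀, ht₀⟩ : ∃ t₀ : ℝ, (t₀ : UnitAddCircle) = χ ⟨w, hwL⟩ :=
      QuotientAddGroup.mk_surjective (χ ⟨w, hwL⟩)
    let t : ℝ := t₀ - round t₀
    have ht : (t : UnitAddCircle) = χ ⟨w, hwL⟩ := by
      rw [← ht₀]
      simp only [t, AddCircle.coe_sub, sub_eq_self]
      rw [AddCircle.coe_eq_zero_iff]
      exact ⟨round t₀, by simp⟩
    have ht2 : t ^ 2 ≤ 1 / 4 := by
      rw [← sq_abs]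
      have := pow_le_pow_left₀ (abs_nonneg _) (abs_sub_round t₀) 2
      norm_num at this ⊢
      exact this
    let ψ : L →+ UnitAddCircle :=
      χ - (QuotientAddGroup.mk' (AddSubgroup.zmultiples (1 : ℝ))).comp
        ((t • μ).toAddMonoidHom.comp L.subtype)
    have hψ : ∀ l : L, ψ l = χ l - ((t * μ l : ℝ) : UnitAddCircle) := fun l => rfl
    let f : L →+ L.map pr.toAddMonoidHom := pr.toAddMonoidHom.addSubgroupMap L
    have hf : ∀ l : L, (f l : E) = pr l := fun l => rfl
    have hfs : Function.Surjective f := pr.toAddMonoidHom.addSubgroupMap_surjective L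
    have hle : f.ker ≤ ψ.ker := by
      intro l hl
      rw [AddMonoidHom.mem_ker] at hl ⊢
      have h0 : pr l = 0 := by rw [← hf, hl]; rfl
      have h1 := hker l l.2 h0
      set k := round (μ (l : E)) with hk
      have h2 : l = k • (⟨w, hwL⟩ : L) := Subtype.ext h1
      have h3 : μ (l : E) = k := by
        rw [h1, map_zsmul, hμw]; simp
      rw [hψ, h3, h2, map_zsmul, ← ht, ← AddCircle.coe_zsmul, zsmul_eq_mul, mul_comm, sub_self]
    obtain ⟨φ, hφ⟩ : ∃ φ : L.map pr.toAddMonoidHom →+ UnitAddCircle, ∀ l, φ (f l) = ψ l :=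
      ⟨f.liftOfSurjective hfs ⟨ψ, hle⟩, fun l => f.liftOfRightInverse_comp_apply _ _ ⟨ψ, hle⟩ l⟩
    obtain ⟨y, hyV, hyn, hy⟩ := ih V' hrank (L.map pr.toAddMonoidHom) (by
        rintro _ ⟨l, hl, rfl⟩
        refine (hV' _).mpr ⟨?_, horth l⟩
        exact V.sub_mem (hL l hl) (V.smul_mem _ (hL w hwL))) (2 / 3 * m) (by positivity) (by
        rintro _ ⟨l, hl, rfl⟩ hne
        change pr l ≠ 0 at hne
        change _ ≤ ‖pr l‖ ^ 2
        have hv0 : l - (round (μ l)) • w ≠ 0 := by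
          intro h
          apply hne
          rw [sub_eq_zero.mp h, map_zsmul, hprw, smul_zero]
        have h1 := hw _ (hmem l hl) hv0
        have h2 := hsmall l
        have h3 := hmin _ (hmem l hl) hv0
        linarith) φ
    rw [hV'] at hyV
    refine ⟨y + (t * (‖w‖ ^ 2)⁻¹) • w, V.add_mem hyV.1 (V.smul_mem _ (hL w hwL)), ?_, fun l => ?_⟩
    · rw [norm_add_sq_real, inner_smul_right, real_inner_comm, hyV.2, norm_smul, mul_pow,
        Real.norm_eq_abs, sq_abs]
      have h1 : (t * (‖w‖ ^ 2)⁻¹) ^ 2 * ‖w‖ ^ 2 = t ^ 2 / ‖w‖ ^ 2 := by field_simp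
      have h2 : t ^ 2 / ‖w‖ ^ 2 ≤ (1 / 4) / m :=
        div_le_div₀ (by norm_num) ht2 hm (hmin w hwL hw0)
      have h3 : ((3 / 2 : ℝ) ^ d - 1) / (2 / 3 * m) = ((3 / 2) ^ (d + 1) - 3 / 2) / m := by
        rw [pow_succ]; field_simp
      rw [h1]
      rw [h3] at hyn
      have h4 : ((3 / 2 : ℝ) ^ (d + 1) - 3 / 2) / m + (1 / 4) / m
          ≤ ((3 / 2) ^ (d + 1) - 1) / m := by
        rw [← add_div]
        gcongr
        linarith
      linarith
    · have h1 := hy (f l)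
      rw [hφ, hψ, hf, hpr, inner_sub_right, inner_smul_right, real_inner_comm w y, hyV.2, mul_zero,
        sub_zero, sub_eq_iff_eq_add, ← AddCircle.coe_add] at h1
      rw [h1, inner_add_left, real_inner_smul_left, hμ, mul_assoc]

/-- Inhomogeneous simultaneous approximation by multiples of `a`, given a lower bound for
the integer linear forms in `1, a₁, …, a_s`. -/
theorem exists_approx_of_linear_forms {s : ℕ} (a : Fin s → ℝ) {N m ε : ℝ} (hN : 0 < N) (hm : 0 < m)
    (hε : 0 ≤ ε) (hεm : (3 / 2) ^ (s + 1) / m ≤ ε ^ 2)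
    (hmin : ∀ (k : ℤ) (h : Fin s → ℤ), (k ≠ 0 ∨ h ≠ 0) →
      m ≤ (N * (k + ∑ i, h i * a i)) ^ 2 + ∑ i, (h i : ℝ) ^ 2) (x : Fin s → ℝ) :
    ∃ (n : ℤ) (b : Fin s → ℤ), |(n : ℝ)| ≤ ε * N ∧ ∀ i, |n * a i - b i - x i| ≤ ε := by
  let ℓ : ℤ × (Fin s → ℤ) →+ EuclideanSpace ℝ (Fin (s + 1)) :=
    { toFun := fun p => WithLp.toLp 2
        (Fin.cons (N * (p.1 + ∑ i, p.2 i * a i)) (fun i => (p.2 i : ℝ)) : Fin (s + 1) → ℝ)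
      map_zero' := by
        ext i
        refine Fin.cases ?_ (fun i => ?_) i <;> simp
      map_add' := by
        intro p p'
        ext i
        refine Fin.cases ?_ (fun i => ?_) i
        · simp [add_mul, Finset.sum_add_distrib]; ring
        · simp }
  have hℓ0 : ∀ p, ℓ p 0 = N * (p.1 + ∑ i, p.2 i * a i) := fun p => rfl
  have hℓs : ∀ p (i : Fin s), ℓ p i.succ = p.2 i := fun p i => rfl
  have hℓn : ∀ p, ‖ℓ p‖ ^ 2 = (N * (p.1 + ∑ i, p.2 i * a i)) ^ 2 + ∑ i, (p.2 i : ℝ) ^ 2 := by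
    intro p
    rw [EuclideanSpace.real_norm_sq_eq, Fin.sum_univ_succ]
    rfl
  have hnz : ∀ p, p ≠ 0 → m ≤ ‖ℓ p‖ ^ 2 := by
    intro p hp
    rw [hℓn]
    apply hmin
    by_contra! h
    exact hp (Prod.ext h.1 h.2)
  have hinj : Function.Injective ℓ := by
    rw [injective_iff_map_eq_zero]
    intro p hp
    by_contra hne
    have := hnz p hne
    rw [hp] at this
    simp at this
    linarith
  let e : (ℤ × (Fin s → ℤ)) ≃+ ℓ.range := AddMonoidHom.ofInjective hinj
  let g : ℤ × (Fin s → ℤ) →+ ℝ :=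
    { toFun := fun p => ∑ i, p.2 i * x i
      map_zero' := by simp
      map_add' := by intro p p'; simp [add_mul, Finset.sum_add_distrib] }
  let χ : ℓ.range →+ UnitAddCircle :=
    ((QuotientAddGroup.mk' (AddSubgroup.zmultiples (1 : ℝ))).comp g).comp e.symm.toAddMonoidHom
  have hχ : ∀ p, χ (e p) = ((∑ i, p.2 i * x i : ℝ) : UnitAddCircle) := by
    intro p
    change ((g (e.symm (e p)) : ℝ) : UnitAddCircle) = _
    rw [AddEquiv.symm_apply_apply]
    rfl
  obtain ⟨y, -, hyn, hy⟩ := exists_short_vector_of_character (s + 1) ⊤ (by simp) ℓ.range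
    (fun _ _ => Submodule.mem_top) m hm (by
      rintro _ ⟨p, rfl⟩ hne
      exact hnz p (by rintro rfl; simp at hne)) χ
  have hycoord : ∀ i, |y i| ≤ ε := by
    intro i
    apply abs_le_of_sq_le_sq _ hε
    have h1 : y i ^ 2 ≤ ‖y‖ ^ 2 := by
      rw [EuclideanSpace.real_norm_sq_eq]
      exact Finset.single_le_sum (f := fun i => y i ^ 2) (fun _ _ => sq_nonneg _)
        (Finset.mem_univ i)
    have h2 : ((3 / 2 : ℝ) ^ (s + 1) - 1) / m ≤ (3 / 2) ^ (s + 1) / m := by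
      gcongr
      linarith
    linarith
  have key : ∀ p : ℤ × (Fin s → ℤ), ∃ z : ℤ,
      (z : ℝ) = y 0 * (N * (p.1 + ∑ i, p.2 i * a i)) + ∑ i, y i.succ * p.2 i
        - ∑ i, p.2 i * x i := by
    intro p
    have h1 := hy (e p)
    rw [hχ] at h1
    have h2 : inner ℝ y ((e p : ℓ.range) : EuclideanSpace ℝ (Fin (s + 1)))
        = y 0 * (N * (p.1 + ∑ i, p.2 i * a i)) + ∑ i, y i.succ * p.2 i := by
      change inner ℝ y (ℓ p) = _
      rw [PiLp.inner_apply, Fin.sum_univ_succ]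
      simp only [hℓ0, hℓs]
      simp [mul_comm]
    rw [h2, eq_comm, ← sub_eq_zero, ← AddCircle.coe_sub, AddCircle.coe_eq_zero_iff] at h1
    obtain ⟨z, hz⟩ := h1
    exact ⟨z, by simpa using hz⟩
  obtain ⟨n, hn⟩ := key (1, 0)
  have hn' : (n : ℝ) = y 0 * N := by simpa using hn
  choose b hb using fun i : Fin s => key (0, Pi.single i 1)
  refine ⟨n, b, ?_, fun i => ?_⟩
  · rw [hn', abs_mul, abs_of_pos hN]
    exact mul_le_mul_of_nonneg_right (hycoord 0) hN.le
  · have h1 := hb i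
    simp only [Pi.single_apply] at h1
    simp at h1
    have h2 : n * a i - b i - x i = -y i.succ := by rw [h1, hn']; ring
    rw [h2, abs_neg]
    exact hycoord _

theorem Nat.Squarefree.eq_of_isSquare_mul {a b : ℕ} (ha : Squarefree a) (hb : Squarefree b)
    (h : IsSquare (a * b)) : a = b := by
  obtain ⟨r, hr⟩ := h
  have ha0 : 0 < a := Nat.pos_of_ne_zero ha.ne_zero
  have hdvd : a ∣ r := by
    rw [← ha.dvd_pow_iff_dvd two_ne_zero, sq, ← hr]
    exact dvd_mul_right a b
  obtain ⟨t, rfl⟩ := hdvd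
  have hbt : b = t * t * a := by
    apply Nat.eq_of_mul_eq_mul_left ha0
    rw [hr]; ring
  have ht : IsUnit t := hb t ⟨a, hbt⟩
  rw [Nat.isUnit_iff.mp ht] at hbt
  omega

section QuadraticIrrationalities

variable {L : Type*} [Field L] [Algebra ℚ L] [FiniteDimensional ℚ L]

theorem Algebra.trace_eq_zero_of_sq_eq {x : L} {m : ℕ} (hm : ¬ IsSquare m) (hx : x ^ 2 = m) :
    Algebra.trace ℚ L x = 0 := by
  have hirr : Irreducible (Polynomial.X ^ 2 - Polynomial.C (m : ℚ)) := by
    apply X_pow_sub_C_irreducible_of_prime Nat.prime_two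
    intro b hb
    exact hm (Rat.isSquare_natCast_iff.mp ⟨b, by rw [← hb, sq]⟩)
  have hmin : Polynomial.X ^ 2 - Polynomial.C (m : ℚ) = minpoly ℚ x := by
    apply minpoly.eq_of_irreducible_of_monic hirr _ (Polynomial.monic_X_pow_sub_C _ two_ne_zero)
    simp [hx]
  have hdeg : (Polynomial.X ^ 2 - Polynomial.C (m : ℚ)).natDegree = 2 :=
    Polynomial.natDegree_X_pow_sub_C
  rw [trace_eq_finrank_mul_minpoly_nextCoeff, ← hmin,
    Polynomial.nextCoeff_of_natDegree_pos (by rw [hdeg]; norm_num), hdeg, Polynomial.coeff_sub,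
    Polynomial.coeff_X_pow, Polynomial.coeff_C]
  simp

theorem eq_zero_of_sum_sqrt_squarefree_eq_zero {s : ℕ} {q : Fin s → ℕ} (hq : Function.Injective q)
    (hsq : ∀ i, Squarefree (q i)) (hq1 : ∀ i, 1 < q i) {r : Fin s → L}
    (hr : ∀ i, r i ^ 2 = q i) {k : ℤ} {h : Fin s → ℤ} (h0 : (k : L) + ∑ i, h i * r i = 0) :
    h = 0 := by
  funext j
  have hns : ¬ IsSquare (q j) := by
    intro hs
    have := Nat.Squarefree.eq_of_isSquare_mul (hsq j) squarefree_one (by simpa using hs)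
    have := hq1 j
    omega
  have htr : ∀ i, i ≠ j → Algebra.trace ℚ L (r i * r j) = 0 := by
    intro i hij
    apply Algebra.trace_eq_zero_of_sq_eq (m := q i * q j)
    · exact fun hs => hij (hq (Nat.Squarefree.eq_of_isSquare_mul (hsq i) (hsq j) hs))
    · rw [mul_pow, hr, hr]; push_cast; ring
  have h1 : k • r j + ∑ i, h i • (r i * r j) = 0 := by
    have := congrArg (· * r j) h0
    simp only [add_mul, Finset.sum_mul, zero_mul] at this
    simpa [zsmul_eq_mul, mul_assoc] using this
  have h2 := congrArg (Algebra.trace ℚ L) h1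
  rw [map_add, map_zsmul, Algebra.trace_eq_zero_of_sq_eq hns (hr j), map_sum, map_zero,
    Finset.sum_eq_single j] at h2
  · rw [map_zsmul, ← sq, hr, show ((q j : ℕ) : L) = algebraMap ℚ L (q j) by simp,
      Algebra.trace_algebraMap] at h2
    have hf : Module.finrank ℚ L ≠ 0 := Module.finrank_pos.ne'
    have hqj : q j ≠ 0 := (hsq j).ne_zero
    simpa [hf, hqj] using h2
  · intro i _ hij
    rw [map_zsmul, htr i hij, smul_zero]
  · simp

/-- Liouville-type lower bound, from the norm of a nonzero integer combination of square roots. -/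
theorem one_le_abs_mul_pow_of_sqrt {s D : ℕ} {q : Fin s → ℕ} {r : Fin s → L}
    (hr : ∀ i, r i ^ 2 = q i) (ι : L →+* ℝ) {k : ℤ} {h : Fin s → ℤ} {B : ℝ} (hB : 1 ≤ B)
    (hkB : |(k : ℝ)| + ∑ i, |(h i : ℝ)| * √(q i) ≤ B) (hD : Module.finrank ℚ L ≤ D)
    (h0 : (k : L) + ∑ i, h i * r i ≠ 0) :
    1 ≤ |ι (k + ∑ i, h i * r i)| * B ^ (D - 1) := by
  classical
  set θ : L := k + ∑ i, h i * r i with hθ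
  have hcast (z : ℤ) : IsIntegral ℤ (z : L) := by
    simpa using isIntegral_algebraMap (R := ℤ) (A := L) (x := z)
  have hintegr : IsIntegral ℤ θ := by
    refine (hcast k).add (IsIntegral.sum _ fun i _ => (hcast (h i)).mul ?_)
    refine IsIntegral.of_pow two_pos ?_
    rw [hr]
    exact_mod_cast hcast (q i)
  have hbound : ∀ σ : L →ₐ[ℚ] ℂ, ‖σ θ‖ ≤ B := by
    intro σ
    have hσr : ∀ i, ‖σ (r i)‖ = √(q i) := by
      intro i
      rw [eq_comm, Real.sqrt_eq_iff_mul_self_eq (by positivity) (by positivity), ← sq, ← norm_pow,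
        ← map_pow, hr]
      simp
    refine le_trans ?_ hkB
    rw [hθ, map_add, map_sum]
    refine (norm_add_le _ _).trans (add_le_add (by simp) ((norm_sum_le _ _).trans ?_))
    refine Finset.sum_le_sum fun i _ => ?_
    rw [map_mul, norm_mul, hσr]
    simp
  obtain ⟨z, hz⟩ : ∃ z : ℤ, algebraMap ℤ ℚ z = Algebra.norm ℚ θ :=
    IsIntegrallyClosed.isIntegral_iff.mp (Algebra.isIntegral_norm ℚ hintegr)
  have hz0 : z ≠ 0 := by
    rintro rfl
    rw [map_zero, eq_comm, Algebra.norm_eq_zero_iff] at hz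
    exact h0 hz
  have hnorm : ‖(z : ℂ)‖ = ∏ σ : L →ₐ[ℚ] ℂ, ‖σ θ‖ := by
    rw [← norm_prod, ← Algebra.norm_eq_prod_embeddings ℚ ℂ θ, ← hz]
    simp
  have hz1 : 1 ≤ ‖(z : ℂ)‖ := by
    rw [Complex.norm_intCast]
    exact_mod_cast Int.one_le_abs hz0
  let σ₀ : L →ₐ[ℚ] ℂ := (Complex.ofRealHom.comp ι).toRatAlgHom
  have hσ₀ : ‖σ₀ θ‖ = |ι θ| := by
    change ‖((ι θ : ℝ) : ℂ)‖ = _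
    simp
  rw [hnorm, ← Finset.mul_prod_erase _ _ (Finset.mem_univ σ₀), hσ₀] at hz1
  refine hz1.trans (mul_le_mul_of_nonneg_left ?_ (abs_nonneg _))
  calc ∏ σ ∈ Finset.univ.erase σ₀, ‖σ θ‖ ≤ ∏ _σ ∈ Finset.univ.erase σ₀, B :=
        Finset.prod_le_prod (fun _ _ => norm_nonneg _) fun σ _ => hbound σ
    _ = B ^ (Module.finrank ℚ L - 1) := by
        rw [Finset.prod_const, Finset.card_erase_of_mem (Finset.mem_univ _), Finset.card_univ,
          AlgHom.card]
    _ ≤ B ^ (D - 1) := pow_le_pow_right₀ hB (by omega)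

end QuadraticIrrationalities

theorem isIntegral_sqrt_natCast (n : ℕ) : IsIntegral ℚ √(n : ℝ) := by
  refine IsIntegral.of_pow two_pos ?_
  rw [Real.sq_sqrt n.cast_nonneg]
  exact isIntegral_algebraMap (x := (n : ℚ))

theorem finrank_adjoin_sqrt_le (S : Finset ℕ) :
    Module.finrank ℚ (IntermediateField.adjoin ℚ ((fun p : ℕ => √(p : ℝ)) '' S)) ≤
      2 ^ S.card := by
  classical
  induction S using Finset.induction_on with
  | empty =>
    rw [Finset.coe_empty, Set.image_empty, IntermediateField.adjoin_empty,
      IntermediateField.finrank_bot, Finset.card_empty, pow_zero]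
  | insert p S hp ih =>
    rw [Finset.coe_insert, Set.image_insert_eq, Set.insert_eq, IntermediateField.adjoin_union,
      Finset.card_insert_of_notMem hp, pow_succ']
    refine (IntermediateField.finrank_sup_le _ _).trans (Nat.mul_le_mul ?_ ih)
    rw [IntermediateField.adjoin.finrank (isIntegral_sqrt_natCast p)]
    have h1 : (Polynomial.X ^ 2 - Polynomial.C (p : ℚ)).natDegree = 2 :=
      Polynomial.natDegree_X_pow_sub_C
    rw [← h1]
    apply Polynomial.natDegree_le_of_dvd
    · apply minpoly.dvd
      simp [Real.sq_sqrt]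
    · exact (Polynomial.monic_X_pow_sub_C _ two_ne_zero).ne_zero

theorem sqrt_mem_adjoin_sqrt (S : Finset ℕ) (n : ℕ) : n ≠ 0 → n.primeFactors ⊆ S →
    √(n : ℝ) ∈ IntermediateField.adjoin ℚ ((fun p : ℕ => √(p : ℝ)) '' S) := by
  induction n using Nat.recOnMul with
  | zero => simp
  | one => intro _ _; simp
  | prime p hp =>
    intro _ hS
    rw [hp.primeFactors, Finset.singleton_subset_iff] at hS
    exact IntermediateField.subset_adjoin _ _ ⟨p, hS, rfl⟩
  | mul a b iha ihb =>
    intro hab hS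
    have ha : a ≠ 0 := left_ne_zero_of_mul hab
    have hb : b ≠ 0 := right_ne_zero_of_mul hab
    rw [Nat.primeFactors_mul ha hb, Finset.union_subset_iff] at hS
    rw [Nat.cast_mul, Real.sqrt_mul a.cast_nonneg]
    exact mul_mem (iha ha hS.1) (ihb hb hS.2)

/-- Lower bound for nonzero integer linear forms in `1, √q₁, …, √q_s`. -/
theorem one_le_abs_linear_form_mul_pow {s : ℕ} {q : Fin s → ℕ} (hq : Function.Injective q)
    (hsq : ∀ i, Squarefree (q i)) (hq1 : ∀ i, 1 < q i) {S : Finset ℕ}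
    (hS : ∀ i, (q i).primeFactors ⊆ S) {k : ℤ} {h : Fin s → ℤ} (h0 : h ≠ 0) {B : ℝ} (hB : 1 ≤ B)
    (hkB : |(k : ℝ)| + ∑ i, |(h i : ℝ)| * √(q i) ≤ B) :
    1 ≤ |k + ∑ i, h i * √(q i)| * B ^ (2 ^ S.card - 1) := by
  let K := IntermediateField.adjoin ℚ ((fun p : ℕ => √(p : ℝ)) '' S)
  have : FiniteDimensional ℚ K := by
    have : Finite ((fun p : ℕ => √(p : ℝ)) '' (S : Set ℕ)) := (S.finite_toSet.image _).to_subtype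
    refine IntermediateField.finiteDimensional_adjoin ?_
    rintro _ ⟨p, -, rfl⟩
    exact isIntegral_sqrt_natCast p
  let r : Fin s → K := fun i => ⟨√(q i), sqrt_mem_adjoin_sqrt S _ (hsq i).ne_zero (hS i)⟩
  have hr : ∀ i, r i ^ 2 = q i := fun i => Subtype.ext (by simp [r, Real.sq_sqrt])
  have := one_le_abs_mul_pow_of_sqrt hr (algebraMap K ℝ) hB hkB (finrank_adjoin_sqrt_le S)
    (fun hz => h0 (eq_zero_of_sum_sqrt_squarefree_eq_zero hq hsq hq1 hr hz))
  simpa [r] using this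

section KroneckerCount

open MeasureTheory

theorem abs_prod_sub_prod_le_sum {ι : Type*} (t : Finset ι) {x y : ι → ℝ}
    (hx : ∀ i, x i ∈ Set.Icc (0 : ℝ) 1) (hy : ∀ i, y i ∈ Set.Icc (0 : ℝ) 1) :
    |∏ i ∈ t, x i - ∏ i ∈ t, y i| ≤ ∑ i ∈ t, |x i - y i| := by
  classical
  induction t using Finset.induction_on with
  | empty => simp
  | insert j t hj ih =>
    rw [Finset.prod_insert hj, Finset.prod_insert hj, Finset.sum_insert hj]
    have h1 : |∏ i ∈ t, x i| ≤ 1 := by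
      rw [Finset.abs_prod]
      exact Finset.prod_le_one (fun _ _ => abs_nonneg _)
        fun i _ => abs_le.mpr ⟨by linarith [(hx i).1], (hx i).2⟩
    have h2 : |y j| ≤ 1 := abs_le.mpr ⟨by linarith [(hy j).1], (hy j).2⟩
    calc |x j * ∏ i ∈ t, x i - y j * ∏ i ∈ t, y i|
        = |(x j - y j) * ∏ i ∈ t, x i + y j * (∏ i ∈ t, x i - ∏ i ∈ t, y i)| := by ring_nf
      _ ≤ |x j - y j| * |∏ i ∈ t, x i| + |y j| * |∏ i ∈ t, x i - ∏ i ∈ t, y i| := by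
          rw [← abs_mul, ← abs_mul]; exact abs_add_le _ _
      _ ≤ |x j - y j| * 1 + 1 * |∏ i ∈ t, x i - ∏ i ∈ t, y i| := by gcongr
      _ ≤ _ := by linarith

theorem Int.fract_add_lt_min {z η δ l : ℝ} (hz : Int.fract z < l) (hη : 0 ≤ η) (hηδ : η ≤ δ) :
    Int.fract (z + η) < min 1 (l + δ) := by
  refine lt_min (Int.fract_lt_one _) ?_
  have h1 : Int.fract (z + η) ≤ Int.fract z + η := by
    have h2 : Int.fract (z + η) = Int.fract (Int.fract z + η) := by
      rw [Int.fract_eq_fract]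
      exact ⟨⌊z⌋, by rw [Int.fract]; ring⟩
    rw [h2]
    have h3 : (0 : ℝ) ≤ ⌊Int.fract z + η⌋ := by
      exact_mod_cast Int.floor_nonneg.mpr (add_nonneg (Int.fract_nonneg _) hη)
    rw [Int.fract]
    linarith
  linarith

theorem Int.fract_mem_Ico_iff_fract_sub_lt {y α β : ℝ} (hα : 0 ≤ α) (hαβ : α ≤ β) (hβ : β ≤ 1) :
    Int.fract y ∈ Set.Ico α β ↔ Int.fract (y - α) < β - α := by
  have h0 := Int.fract_nonneg y
  have h1 := Int.fract_lt_one y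
  have h2 : Int.fract (y - α) = Int.fract (Int.fract y - α) := by
    rw [Int.fract_eq_fract]
    exact ⟨⌊y⌋, by rw [Int.fract]; ring⟩
  rw [h2, Set.mem_Ico]
  constructor
  · rintro ⟨ha, hb⟩
    rw [Int.fract_eq_self.mpr ⟨by linarith, by linarith⟩]
    linarith
  · intro h
    by_cases hle : α ≤ Int.fract y
    · rw [Int.fract_eq_self.mpr ⟨by linarith, by linarith⟩] at h
      exact ⟨hle, by linarith⟩
    · exfalso
      push Not at hle
      have h3 : Int.fract (Int.fract y - α) = Int.fract y - α + 1 := by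
        rw [Int.fract_eq_iff]
        exact ⟨by linarith, by linarith, -1, by push_cast; ring⟩
      linarith

theorem integral_indicator_fract_sub_lt (c : ℝ) {l : ℝ} (hl : l ∈ Set.Icc (0 : ℝ) 1) :
    ∫ u in Set.Ioc (0 : ℝ) 1, (if Int.fract (c - u) < l then (1 : ℝ) else 0) = l := by
  let f : ℝ → ℝ := fun v => if Int.fract v < l then 1 else 0
  have hper : Function.Periodic f 1 := fun v => by simp [f]
  rw [← intervalIntegral.integral_of_le zero_le_one]
  change ∫ u in (0 : ℝ)..1, f (c - u) = l
  rw [intervalIntegral.integral_comp_sub_left f c]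
  have h1 := hper.intervalIntegral_add_eq (c - 1) 0
  rw [show c - 1 + 1 = c by ring, zero_add] at h1
  rw [sub_zero, h1, intervalIntegral.integral_of_le zero_le_one, ← integral_Ico_eq_integral_Ioc]
  have h2 : ∀ v ∈ Set.Ico (0 : ℝ) 1, f v = (Set.Ico 0 l).indicator 1 v := by
    intro v hv
    simp only [f, Int.fract_eq_self.mpr hv, Set.indicator_apply, Set.mem_Ico, hv.1, true_and,
      Pi.one_apply]
  rw [setIntegral_congr_fun measurableSet_Ico h2, integral_indicator_one measurableSet_Ico,
    measureReal_restrict_apply measurableSet_Ico, Set.inter_eq_left.mpr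
      (Set.Ico_subset_Ico_right hl.2)]
  simp [hl.1]

/-- Number of `n ∈ (N, 2N]` for which `n a` lies, modulo one, in the box with corner `u` and side
lengths `l`. -/
noncomputable def kroneckerCount {s : ℕ} (a : Fin s → ℝ) (N : ℕ) (u l : Fin s → ℝ) : ℝ :=
  ∑ n ∈ Finset.Ioc (N : ℤ) (2 * N), ∏ i, if Int.fract (n * a i - u i) < l i then (1 : ℝ) else 0

theorem kroneckerCount_eq_card {s : ℕ} (a : Fin s → ℝ) (N : ℕ) (u l : Fin s → ℝ)
    [DecidablePred fun n : ℤ => ∀ i, Int.fract (n * a i - u i) < l i] :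
    kroneckerCount a N u l =
      ((Finset.Ioc (N : ℤ) (2 * N)).filter
        fun n : ℤ => ∀ i, Int.fract (n * a i - u i) < l i).card := by
  rw [kroneckerCount, Finset.card_filter, Nat.cast_sum]
  refine Finset.sum_congr rfl fun n _ => ?_
  rw [Finset.prod_ite_zero]
  simp

theorem exists_kroneckerCount_le_and_ge {s : ℕ} (a : Fin s → ℝ) (N : ℕ) {l : Fin s → ℝ}
    (hl : ∀ i, l i ∈ Set.Icc (0 : ℝ) 1) :
    (∃ u, kroneckerCount a N u l ≤ N * ∏ i, l i) ∧ ∃ u, N * ∏ i, l i ≤ kroneckerCount a N u l := by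
  let ν : Measure ℝ := volume.restrict (Set.Ioc 0 1)
  have : IsProbabilityMeasure ν := ⟨by simp [ν]⟩
  let μ : Measure (Fin s → ℝ) := Measure.pi fun _ => ν
  have hintegrable_factor : ∀ c l : ℝ,
      Integrable (fun u : ℝ => if Int.fract (c - u) < l then (1 : ℝ) else 0)
      ν := by
    intro c l
    refine Integrable.of_bound (C := 1) ?_ (Filter.Eventually.of_forall fun u => ?_)
    · refine (Measurable.ite ?_ measurable_const measurable_const).aestronglyMeasurable
      exact measurableSet_lt (measurable_fract.comp (measurable_const.sub measurable_id))
        measurable_const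
    · split_ifs <;> simp
  have hintegr : ∀ n : ℤ, Integrable (fun u : Fin s → ℝ =>
      ∏ i, if Int.fract (n * a i - u i) < l i then (1 : ℝ) else 0) μ := fun n =>
    Integrable.fintype_prod (f := fun i v => if Int.fract (n * a i - v) < l i then (1 : ℝ) else 0)
      fun i => hintegrable_factor _ _
  have hI : ∫ u, kroneckerCount a N u l ∂μ = N * ∏ i, l i := by
    unfold kroneckerCount
    rw [integral_finsetSum _ fun n _ => hintegr n]
    have h1 : ∀ n : ℤ, ∫ u : Fin s → ℝ,
        (∏ i, if Int.fract (n * a i - u i) < l i then (1 : ℝ) else 0) ∂μ = ∏ i, l i := by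
      intro n
      rw [integral_fintype_prod_eq_prod
        (fun i v => if Int.fract (n * a i - v) < l i then (1 : ℝ) else 0)]
      exact Finset.prod_congr rfl fun i _ => integral_indicator_fract_sub_lt _ (hl i)
    simp only [h1, Finset.sum_const, Int.card_Ioc, nsmul_eq_mul]
    congr 2
    omega
  have hintegrable_count : Integrable (fun u => kroneckerCount a N u l) μ :=
    integrable_finsetSum _ fun n _ => hintegr n
  rw [← hI]
  exact ⟨exists_le_integral hintegrable_count, exists_integral_le hintegrable_count⟩

theorem kroneckerCount_le_add {s : ℕ} (a : Fin s → ℝ) (N : ℕ) {ε : ℝ}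
    (happrox : ∀ x : Fin s → ℝ, ∃ (n : ℤ) (b : Fin s → ℤ), |(n : ℝ)| ≤ ε * N ∧
      ∀ i, |n * a i - b i - x i| ≤ ε) (u u' l : Fin s → ℝ) :
    kroneckerCount a N u l ≤ kroneckerCount a N u' (fun i => min 1 (l i + 2 * ε)) + ε * N := by
  classical
  obtain ⟨k, b, hk, hb⟩ := happrox fun i => u' i - u i + ε
  rw [kroneckerCount_eq_card, kroneckerCount_eq_card]
  set A := (Finset.Ioc (N : ℤ) (2 * N)).filter fun n : ℤ => ∀ i, Int.fract (n * a i - u i) < l i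
  set A' := (Finset.Ioc (N : ℤ) (2 * N)).filter
    fun n : ℤ => ∀ i, Int.fract (n * a i - u' i) < min 1 (l i + 2 * ε)
  have hsub : A.image (· + k) ⊆
      A' ∪ (Finset.Ioc (N + k : ℤ) (2 * N + k) \ Finset.Ioc (N : ℤ) (2 * N)) := by
    intro n' hn'
    obtain ⟨n, hn, rfl⟩ := Finset.mem_image.mp hn'
    rw [Finset.mem_filter, Finset.mem_Ioc] at hn
    rw [Finset.mem_union, Finset.mem_sdiff, Finset.mem_filter]
    by_cases hmem : n + k ∈ Finset.Ioc (N : ℤ) (2 * N)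
    · refine Or.inl ⟨hmem, fun i => ?_⟩
      have h1 := abs_le.mp (hb i)
      have h2 := Int.fract_add_lt_min (hn.2 i)
        (η := k * a i - b i - (u' i - u i)) (δ := 2 * ε) (by linarith) (by linarith)
      have h3 : Int.fract (((n + k : ℤ) : ℝ) * a i - u' i)
          = Int.fract (n * a i - u i + (k * a i - b i - (u' i - u i))) := by
        rw [Int.fract_eq_fract]
        exact ⟨b i, by push_cast; ring⟩
      rwa [h3]
    · exact Or.inr ⟨Finset.mem_Ioc.mpr ⟨by omega, by omega⟩, hmem⟩
  have hsd : (Finset.Ioc (N + k : ℤ) (2 * N + k) \ Finset.Ioc (N : ℤ) (2 * N)).card ≤ k.natAbs := by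
    rcases le_total 0 k with h | h
    · have h1 : Finset.Ioc (N + k : ℤ) (2 * N + k) \ Finset.Ioc (N : ℤ) (2 * N)
          ⊆ Finset.Ioc (2 * N : ℤ) (2 * N + k) := by
        intro n
        simp only [Finset.mem_sdiff, Finset.mem_Ioc]
        omega
      refine (Finset.card_le_card h1).trans ?_
      rw [Int.card_Ioc]
      omega
    · have h1 : Finset.Ioc (N + k : ℤ) (2 * N + k) \ Finset.Ioc (N : ℤ) (2 * N)
          ⊆ Finset.Ioc (N + k : ℤ) N := by
        intro n
        simp only [Finset.mem_sdiff, Finset.mem_Ioc]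
        omega
      refine (Finset.card_le_card h1).trans ?_
      rw [Int.card_Ioc]
      omega
  have hcard : A.card ≤ A'.card + k.natAbs := by
    rw [← Finset.card_image_of_injective A (add_left_injective k)]
    exact (Finset.card_le_card hsub).trans ((Finset.card_union_le _ _).trans (by omega))
  have h1 : (A.card : ℝ) ≤ A'.card + (k.natAbs : ℝ) := by exact_mod_cast hcard
  rw [Nat.cast_natAbs, Int.cast_abs] at h1
  linarith

theorem abs_kroneckerCount_div_sub_le {s : ℕ} (a : Fin s → ℝ) {N : ℕ} (hN : 0 < N) {ε : ℝ}
    (hε : 0 ≤ ε)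
    (happrox : ∀ x : Fin s → ℝ, ∃ (n : ℤ) (b : Fin s → ℤ), |(n : ℝ)| ≤ ε * N ∧
      ∀ i, |n * a i - b i - x i| ≤ ε) (u : Fin s → ℝ) {l : Fin s → ℝ}
    (hl : ∀ i, l i ∈ Set.Icc (0 : ℝ) 1) :
    |kroneckerCount a N u l / N - ∏ i, l i| ≤ (2 * s + 1) * ε := by
  have hN' : (0 : ℝ) < N := by exact_mod_cast hN
  have hs : (0 : ℝ) ≤ s := s.cast_nonneg
  have hsum : ∀ l' : Fin s → ℝ, (∀ i, |l i - l' i| ≤ 2 * ε) → ∑ i, |l i - l' i| ≤ 2 * s * ε := by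
    intro l' h
    refine (Finset.sum_le_sum fun i _ => h i).trans ?_
    simp
    linarith
  rw [abs_le]
  constructor
  · have hcount0 : 0 ≤ kroneckerCount a N u l / N := by
      refine div_nonneg (Finset.sum_nonneg fun n _ => Finset.prod_nonneg fun i _ => ?_) hN'.le
      split_ifs <;> simp
    by_cases hsmall : ∃ j, l j < 2 * ε
    · obtain ⟨j, hj⟩ := hsmall
      have h1 : ∏ i, l i ≤ l j := by
        rw [← Finset.mul_prod_erase _ _ (Finset.mem_univ j)]
        exact mul_le_of_le_one_right (hl j).1
          (Finset.prod_le_one (fun i _ => (hl i).1) fun i _ => (hl i).2)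
      have h2 : (1 : ℝ) ≤ s := by
        have := j.pos
        exact_mod_cast this
      nlinarith
    · push Not at hsmall
      let l' : Fin s → ℝ := fun i => l i - 2 * ε
      have hl' : ∀ i, l' i ∈ Set.Icc (0 : ℝ) 1 := fun i =>
        ⟨by simp only [l']; linarith [hsmall i], by simp only [l']; linarith [(hl i).2]⟩
      obtain ⟨u', hu'⟩ := (exists_kroneckerCount_le_and_ge a N hl').2
      have h1 := kroneckerCount_le_add a N happrox u' u l'
      have h2 : (fun i => min 1 (l' i + 2 * ε)) = l := by
        funext i
        simp only [l', sub_add_cancel]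
        exact min_eq_right (hl i).2
      rw [h2] at h1
      have h3 := (abs_le.mp ((abs_prod_sub_prod_le_sum Finset.univ hl hl').trans
        (hsum l' fun i => by simp [l', abs_of_nonneg hε]))).2
      have h4 : ∏ i, l' i - ε ≤ kroneckerCount a N u l / N := by
        rw [le_div_iff₀ hN']
        linarith
      linarith
  · let l' : Fin s → ℝ := fun i => min 1 (l i + 2 * ε)
    have hl' : ∀ i, l' i ∈ Set.Icc (0 : ℝ) 1 := fun i =>
      ⟨le_min zero_le_one (by linarith [(hl i).1]), min_le_left _ _⟩
    have hdiff : ∀ i, |l i - l' i| ≤ 2 * ε := by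
      intro i
      rw [abs_le]
      have h1 : l' i ≤ l i + 2 * ε := min_le_right _ _
      have h2 : l i ≤ l' i := le_min (hl i).2 (by linarith)
      constructor <;> linarith
    obtain ⟨u', hu'⟩ := (exists_kroneckerCount_le_and_ge a N hl').1
    have h1 := kroneckerCount_le_add a N happrox u u' l
    have h3 := (abs_le.mp ((abs_prod_sub_prod_le_sum Finset.univ hl hl').trans (hsum l' hdiff))).1
    have h4 : kroneckerCount a N u l / N ≤ ∏ i, l' i + ε := by
      rw [div_le_iff₀ hN']
      change _ ≤ kroneckerCount a N u' l' + _ at h1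
      linarith
    linarith

end KroneckerCount

theorem le_two_mul_two_pow_card_primes {T : ℝ} (hT : 2 ≤ T) :
    T ≤ 2 * 2 ^ (Nat.primesBelow (⌊T ^ 2⌋₊ + 1)).card := by
  set X := ⌊T ^ 2⌋₊ with hX
  have hX4 : 4 ≤ X := Nat.le_floor (by push_cast; nlinarith)
  have h1 := Nat.smoothNumbersUpTo_card_le X (X + 1)
  have h2 : X ≤ (Nat.smoothNumbersUpTo X (X + 1)).card := by
    calc X = (Finset.Icc 1 X).card := by simp
      _ ≤ _ := by
        refine Finset.card_le_card fun n hn => ?_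
        rw [Finset.mem_Icc] at hn
        rw [Nat.mem_smoothNumbersUpTo]
        exact ⟨hn.2, Nat.mem_smoothNumbers_of_lt (by omega) (by omega)⟩
  set M := 2 ^ (Nat.primesBelow (X + 1)).card with hM
  have h3 : X.sqrt * X.sqrt ≤ M * X.sqrt := (Nat.sqrt_le X).trans (h2.trans h1)
  have h4 : X.sqrt ≤ M := Nat.le_of_mul_le_mul_right h3 (Nat.sqrt_pos.mpr (by omega))
  have h5 : X + 1 ≤ (M + 1) * (M + 1) :=
    (Nat.lt_succ_sqrt X).trans_le (Nat.mul_le_mul (by simpa using h4) (by simpa using h4))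
  have h6 : T ^ 2 < X + 1 := Nat.lt_floor_add_one _
  have h7 : (X : ℝ) + 1 ≤ (M + 1) * (M + 1) := by exact_mod_cast h5
  have h8 : (1 : ℝ) ≤ M := by exact_mod_cast Nat.one_le_two_pow
  have h9 : (M : ℝ) = 2 ^ (Nat.primesBelow (X + 1)).card := by rw [hM]; push_cast; rfl
  rw [← h9]
  nlinarith

/-- Lower bound for the vectors `(N (k + h·√q), h)` with `(k, h) ≠ 0`. -/
theorem sq_le_linear_forms_sqrt {s : ℕ} (hs : 0 < s) {q : Fin s → ℕ} (hq : Function.Injective q)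
    (hsq : ∀ i, Squarefree (q i)) (hq1 : ∀ i, 1 < q i) {S : Finset ℕ}
    (hS : ∀ i, (q i).primeFactors ⊆ S) {T : ℝ} (hT : 2 ≤ T) (hqT : ∀ i, (q i : ℝ) ≤ T ^ 2)
    {H N : ℝ} (hH : 1 ≤ H) (hHN : (3 * s * T * H) ^ 2 ^ S.card = N) (k : ℤ) (h : Fin s → ℤ)
    (hkh : k ≠ 0 ∨ h ≠ 0) :
    H ^ 2 ≤ (N * (k + ∑ i, h i * √(q i))) ^ 2 + ∑ i, (h i : ℝ) ^ 2 := by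
  have hs1 : (1 : ℝ) ≤ s := by exact_mod_cast hs
  have hsT : 1 ≤ s * T := by nlinarith
  set B := 3 * s * T * H with hB
  have hBsT : 1 + 2 * (s * T * H) ≤ B := by nlinarith
  have hHB : H ≤ B := by nlinarith
  have hB1 : 1 ≤ B := hH.trans hHB
  have hpow : B * B ^ (2 ^ S.card - 1) = N := by
    rw [← hHN, ← pow_succ', Nat.sub_add_cancel Nat.one_le_two_pow]
  have hpow1 : 1 ≤ B ^ (2 ^ S.card - 1) := one_le_pow₀ hB1
  have hHN' : H ≤ N := by nlinarith
  have hsum0 : 0 ≤ ∑ i, (h i : ℝ) ^ 2 := Finset.sum_nonneg fun i _ => sq_nonneg _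
  set θ : ℝ := k + ∑ i, h i * √(q i) with hθ
  have hlarge : H ≤ N * |θ| → H ^ 2 ≤ (N * θ) ^ 2 + ∑ i, (h i : ℝ) ^ 2 := by
    intro hle
    have h1 : H ^ 2 ≤ (N * |θ|) ^ 2 := pow_le_pow_left₀ (by linarith) hle 2
    rw [mul_pow, sq_abs, ← mul_pow] at h1
    linarith
  by_cases hθ1 : 1 ≤ |θ|
  · exact hlarge (by nlinarith)
  push Not at hθ1
  by_cases h0 : h = 0
  · exfalso
    have hk : k ≠ 0 := hkh.resolve_right (by simpa using h0)
    have h1 : θ = k := by simp [hθ, h0]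
    rw [h1] at hθ1
    have h2 : (1 : ℝ) ≤ |(k : ℝ)| := by exact_mod_cast Int.one_le_abs hk
    linarith
  by_cases hbig : ∃ i, H ≤ |(h i : ℝ)|
  · obtain ⟨i, hi⟩ := hbig
    have h1 : H ^ 2 ≤ (h i : ℝ) ^ 2 := by
      rw [← sq_abs (h i : ℝ)]
      exact pow_le_pow_left₀ (by linarith) hi 2
    have h2 : (h i : ℝ) ^ 2 ≤ ∑ i, (h i : ℝ) ^ 2 :=
      Finset.single_le_sum (f := fun i => (h i : ℝ) ^ 2) (fun _ _ => sq_nonneg _)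
        (Finset.mem_univ i)
    have h3 := sq_nonneg (N * θ)
    linarith
  push Not at hbig
  have hsum : ∑ i, |(h i : ℝ)| * √(q i) ≤ s * T * H := by
    have h1 : ∀ i ∈ Finset.univ, |(h i : ℝ)| * √(q i) ≤ H * T := fun i _ =>
      mul_le_mul (hbig i).le (Real.sqrt_le_iff.mpr ⟨by linarith, hqT i⟩) (by positivity)
        (by linarith)
    refine (Finset.sum_le_sum h1).trans (le_of_eq ?_)
    simp
    ring
  have hk : |(k : ℝ)| ≤ 1 + s * T * H := by
    have h1 : (k : ℝ) = θ - ∑ i, h i * √(q i) := by rw [hθ]; ring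
    have h2 : |∑ i, (h i : ℝ) * √(q i)| ≤ s * T * H := by
      refine (Finset.abs_sum_le_sum_abs _ _).trans (le_trans (le_of_eq ?_) hsum)
      exact Finset.sum_congr rfl fun i _ => by rw [abs_mul, abs_of_nonneg (Real.sqrt_nonneg _)]
    rw [h1]
    exact (abs_sub _ _).trans (add_le_add hθ1.le h2)
  have hnorm := one_le_abs_linear_form_mul_pow hq hsq hq1 hS h0 hB1
    (show |(k : ℝ)| + ∑ i, |(h i : ℝ)| * √(q i) ≤ B by linarith)
  rw [← hθ] at hnorm
  apply hlarge
  calc H ≤ B * 1 := by linarith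
    _ ≤ B * (|θ| * B ^ (2 ^ S.card - 1)) := by gcongr
    _ = N * |θ| := by rw [← hpow]; ring

theorem discrepancy_constant_bound {s : ℕ} (hs : 0 < s) :
    (2 * s + 1) * (2 ^ (s + 1) * (3 * s * 2)) ≤ (288 : ℝ) ^ s := by
  have hs1 : (1 : ℝ) ≤ s := by exact_mod_cast hs
  have h1 : (s : ℝ) ≤ 2 ^ s := by exact_mod_cast Nat.lt_two_pow_self.le
  have h2 : (36 : ℝ) ≤ 36 ^ s := le_self_pow₀ (by norm_num) hs.ne'
  have h3 : (2 * s + 1 : ℝ) ≤ 3 * 2 ^ s := by linarith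
  calc (2 * s + 1) * (2 ^ (s + 1) * (3 * s * 2))
      ≤ (3 * 2 ^ s) * (2 ^ (s + 1) * (3 * 2 ^ s * 2) : ℝ) := by gcongr
    _ = 36 * (2 ^ s * 2 ^ s * 2 ^ s) := by rw [pow_succ]; ring
    _ ≤ 36 ^ s * (2 ^ s * 2 ^ s * 2 ^ s) := by gcongr
    _ = 288 ^ s := by rw [← mul_pow, ← mul_pow, ← mul_pow]; norm_num

open Finset Classical in
/-- Discrepancy bound for the sequence `(n√q₁, …, n√q_s)`, `N < n ≤ 2N`, where
`q₁ < ⋯ < q_s` are all squarefree integers in `(1, T²]` and `P = π(T²)`.  The discrepancy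
bound is expressed by its defining property: for every box `∏ [αᵢ, βᵢ) ⊆ [0,1)^s` the
deviation of the counting quotient from the volume is at most the stated quantity. -/
theorem discrepancy_sqrt_squarefree :
    ∃ c : ℝ, 0 < c ∧
      ∀ (T : ℝ), 2 ≤ T →
      ∀ (s : ℕ) (q : Fin s → ℕ), StrictMono q →
        (∀ n : ℕ, (Squarefree n ∧ 1 < n ∧ (n : ℝ) ≤ T ^ 2) ↔ ∃ i, q i = n) →
      ∀ (P : ℕ), P = Nat.card {p : ℕ | p.Prime ∧ (p : ℝ) ≤ T ^ 2} →
      ∀ (N : ℕ), 0 < N →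
        Real.exp 1 ≤ (N : ℝ) ^ ((2 : ℝ) ^ (-(P : ℝ))) / (3 * s * T) →
        ∀ (α β : Fin s → ℝ), (∀ i, 0 ≤ α i ∧ α i ≤ β i ∧ β i ≤ 1) →
          |(((Finset.Ioc N (2 * N)).filter
                (fun n : ℕ => ∀ i, Int.fract ((n : ℝ) * Real.sqrt (q i)) ∈ Set.Ico (α i) (β i))).card : ℝ)
                / N
              - ∏ i, (β i - α i)|
            ≤ c ^ s * (s.factorial : ℝ) * (N : ℝ) ^ (-(2 : ℝ) ^ (-(P : ℝ))) * Real.log N ^ 2 := by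
  refine ⟨288, by norm_num, ?_⟩
  intro T hT s q hqmono hq P hP N hN hexp α β hαβ
  obtain ⟨hsq, hq1, hqT⟩ : (∀ i, Squarefree (q i)) ∧ (∀ i, 1 < q i) ∧
      ∀ i, (q i : ℝ) ≤ T ^ 2 :=
    ⟨fun i => ((hq _).mpr ⟨i, rfl⟩).1, fun i => ((hq _).mpr ⟨i, rfl⟩).2.1,
      fun i => ((hq _).mpr ⟨i, rfl⟩).2.2⟩
  have hs : 0 < s := by
    obtain ⟨i, -⟩ := (hq 2).mp ⟨Nat.prime_two.squarefree, by norm_num, by push_cast; nlinarith⟩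
    exact i.pos
  have hs1 : (1 : ℝ) ≤ s := by exact_mod_cast hs
  set S := Nat.primesBelow (⌊T ^ 2⌋₊ + 1) with hS
  have hprimes : ∀ p, p ∈ S ↔ p.Prime ∧ (p : ℝ) ≤ T ^ 2 := by
    intro p
    rw [hS, Nat.mem_primesBelow, Nat.lt_succ_iff, Nat.le_floor_iff (by positivity), and_comm]
  have hPS : P = S.card := by
    have h1 : {p : ℕ | p.Prime ∧ (p : ℝ) ≤ T ^ 2} = (S : Set ℕ) := by
      ext p
      rw [Finset.mem_coe, hprimes]
      rfl
    rw [hP, h1, Nat.card_coe_set_eq, Set.ncard_coe_finset]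
  have hqS : ∀ i, (q i).primeFactors ⊆ S := by
    intro i p hp
    rw [hprimes]
    refine ⟨Nat.prime_of_mem_primeFactors hp, le_trans ?_ (hqT i)⟩
    exact_mod_cast Nat.le_of_mem_primeFactors hp
  have hN' : (0 : ℝ) < N := by exact_mod_cast hN
  set X : ℝ := (N : ℝ) ^ ((2 : ℝ) ^ (-(P : ℝ))) with hX
  set H : ℝ := X / (3 * s * T) with hH
  have hX0 : 0 < X := Real.rpow_pos_of_pos hN' _
  have hsT : 0 < 3 * s * T := by positivity
  have hHX : 3 * s * T * H = X := by rw [hH]; field_simp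
  have hH1 : 1 ≤ H := le_trans (Real.one_le_exp zero_le_one) hexp
  have htwo : (2 : ℝ) ^ (-(P : ℝ)) * 2 ^ P = 1 := by
    rw [Real.rpow_neg zero_le_two, Real.rpow_natCast]
    exact inv_mul_cancel₀ (by positivity)
  have hXN : X ^ 2 ^ P = N := by
    rw [hX, ← Real.rpow_natCast, ← Real.rpow_mul hN'.le]
    push_cast
    rw [htwo, Real.rpow_one]
  have hlog : (2 : ℝ) ^ P ≤ Real.log N := by
    have hsT1 : 1 ≤ 3 * s * T := by nlinarith
    have h1 : Real.exp 1 ≤ X := by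
      rw [← hHX]
      exact hexp.trans (le_mul_of_one_le_left (by linarith) hsT1)
    have h2 : 1 ≤ Real.log X := (Real.le_log_iff_exp_le hX0).mpr h1
    rw [← hXN, Real.log_pow]
    push_cast
    exact le_mul_of_one_le_right (by positivity) h2
  have hTlog : T ≤ 2 * Real.log N ^ 2 := by
    have h1 := le_two_mul_two_pow_card_primes hT
    rw [← hS, ← hPS] at h1
    have h2 : (1 : ℝ) ≤ 2 ^ P := one_le_pow₀ one_le_two
    nlinarith
  set ε : ℝ := 2 ^ (s + 1) / H with hε
  have hε0 : 0 ≤ ε := by positivity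
  have hεH : (3 / 2) ^ (s + 1) / H ^ 2 ≤ ε ^ 2 := by
    have h1 : ((2 : ℝ) ^ (s + 1)) ^ 2 = 4 ^ (s + 1) := by
      rw [← pow_mul, mul_comm, pow_mul]
      norm_num
    rw [hε, div_pow _ H, h1]
    gcongr
    norm_num
  have happrox := exists_approx_of_linear_forms (fun i => √(q i)) hN' (by positivity) hε0 hεH
    (sq_le_linear_forms_sqrt hs hqmono.injective hsq hq1 hqS hT hqT hH1
      (by rw [hHX, ← hPS, hXN]))
  have hdisc := abs_kroneckerCount_div_sub_le (fun i => √(q i)) hN hε0 happrox α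
    (l := fun i => β i - α i) fun i =>
      ⟨by linarith [(hαβ i).2.1], by linarith [(hαβ i).1, (hαβ i).2.2]⟩
  have hcount : kroneckerCount (fun i => √(q i)) N α (fun i => β i - α i) =
      (((Finset.Ioc N (2 * N)).filter
        (fun n : ℕ => ∀ i, Int.fract ((n : ℝ) * Real.sqrt (q i)) ∈ Set.Ico (α i) (β i))).card
          : ℝ) := by
    rw [kroneckerCount_eq_card, Nat.cast_inj, eq_comm]
    have hiff : ∀ (n : ℕ) (i : Fin s), Int.fract ((n : ℝ) * √(q i)) ∈ Set.Ico (α i) (β i) ↔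
        Int.fract (((n : ℤ) : ℝ) * √(q i) - α i) < β i - α i := fun n i => by
      rw [Int.fract_mem_Ico_iff_fract_sub_lt (hαβ i).1 (hαβ i).2.1 (hαβ i).2.2, Int.cast_natCast]
    refine Finset.card_bij (fun n _ => (n : ℤ)) ?_ (fun _ _ _ _ h => by exact_mod_cast h) ?_
    · intro n hn
      simp only [Finset.mem_filter, Finset.mem_Ioc, hiff] at hn ⊢
      exact ⟨by omega, hn.2⟩
    · intro n hn
      simp only [Finset.mem_filter, Finset.mem_Ioc] at hn
      lift n to ℕ using by omega
      refine ⟨n, ?_, rfl⟩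
      simp only [Finset.mem_filter, Finset.mem_Ioc, hiff]
      exact ⟨by omega, hn.2⟩
  rw [hcount] at hdisc
  refine hdisc.trans ?_
  have hXinv : (N : ℝ) ^ (-(2 : ℝ) ^ (-(P : ℝ))) = X⁻¹ := by rw [Real.rpow_neg hN'.le]
  have hεX : ε = 2 ^ (s + 1) * (3 * s * T) * X⁻¹ := by
    rw [hε, hH]
    field_simp
  have hfact : (1 : ℝ) ≤ s.factorial := by exact_mod_cast s.factorial_pos
  rw [hXinv, hεX]
  calc (2 * s + 1) * (2 ^ (s + 1) * (3 * s * T) * X⁻¹)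
      ≤ (2 * s + 1) * (2 ^ (s + 1) * (3 * s * (2 * Real.log N ^ 2)) * X⁻¹) := by gcongr
    _ = (2 * s + 1) * (2 ^ (s + 1) * (3 * s * 2)) * 1 * X⁻¹ * Real.log N ^ 2 := by ring
    _ ≤ 288 ^ s * s.factorial * X⁻¹ * Real.log N ^ 2 := by
        gcongr
        exact discrepancy_constant_bound hs
end
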